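/- Jump-sum bound for controlled brackets: let 1 ≤ q_0 < ∞, 0 < q_1 ≤ ∞, 1/q = 1/q_0 + 1/q_1, let g be a càdlàg martingale, Y' a càdlàg adapted process, I ⊂ (0,∞) countable, and (Δ_t)_{t∈I} a deterministic real sequence. Define B_{t,t'} := Σ_{j ∈ I ∩ (t,t']} Y'_{j-} Δ_j (g_j − g_{j-}). Then for every p_1 ∈ [2,∞] and 1/r < 1/2 + 1/p_1, ‖V^r B‖_{L^q} ≤ C ‖sup_t |Y'_t|‖_{L^{q_1}} · (Σ_{j∈I} |Δ_j|^{p_1})^{1/p_1} · ‖(Σ_{j∈I} |g_j − g_{j-}|²)^{1/2}‖_{L^{q_0}}. -/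

import Mathlib

open MeasureTheory ENNReal Filter Set Function
open scoped NNReal

/-- A càdlàg (right-continuous with left limits) real-valued path on `[0,∞)`. -/
def Cadlag (f : ℝ≥0 → ℝ) : Prop :=
  (∀ t, Tendsto f (nhdsWithin t (Set.Ici t)) (nhds (f t))) ∧
  (∀ t, 0 < t → ∃ L, Tendsto f (nhdsWithin t (Set.Iio t)) (nhds L))

/-- The `r`-variation of a two-parameter process indexed by continuous time. -/
noncomputable def VvarR (r : ℝ) (P : ℝ≥0 → ℝ≥0 → ℝ) : ℝ≥0∞ :=
  ⨆ (L : ℕ) (u : Fin (L + 1) → ℝ≥0) (_ : Monotone u),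
    (∑ l : Fin L, (ENNReal.ofReal |P (u l.castSucc) (u l.succ)|) ^ r) ^ (1 / r)

/-- The `L^q` "norm" (for `q ∈ (0,∞]`) of an `ℝ≥0∞`-valued function. -/
noncomputable def lqNorm {Ω : Type*} [MeasurableSpace Ω] (μ : Measure Ω) (q : ℝ≥0∞)
    (f : Ω → ℝ≥0∞) : ℝ≥0∞ :=
  if q = ∞ then essSup f μ else (∫⁻ ω, f ω ^ q.toReal ∂μ) ^ (1 / q.toReal)

/-- The `r`-variation of a real sequence. -/
noncomputable def seqVar (r : ℝ) (f : ℕ → ℝ) : ℝ≥0∞ :=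
  ⨆ (L : ℕ) (u : Fin (L + 1) → ℕ) (_ : Monotone u),
    (∑ l : Fin L, (ENNReal.ofReal |f (u l.succ) - f (u l.castSucc)|) ^ r) ^ (1 / r)

lemma seqVar_le_iff {r : ℝ} {f : ℕ → ℝ} {A : ℝ≥0∞} :
    seqVar r f ≤ A ↔ ∀ (L : ℕ) (u : Fin (L + 1) → ℕ), Monotone u →
      (∑ l : Fin L, (ENNReal.ofReal |f (u l.succ) - f (u l.castSucc)|) ^ r) ^ (1 / r) ≤ A := by
  simp only [seqVar, iSup_le_iff]

lemma le_seqVar (r : ℝ) (f : ℕ → ℝ) {L : ℕ} {u : Fin (L + 1) → ℕ} (hu : Monotone u) :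
    (∑ l : Fin L, (ENNReal.ofReal |f (u l.succ) - f (u l.castSucc)|) ^ r) ^ (1 / r)
      ≤ seqVar r f :=
  seqVar_le_iff.1 le_rfl L u hu

lemma seqVar_comp_le (r : ℝ) (f : ℕ → ℝ) {φ : ℕ → ℕ} (hφ : Monotone φ) :
    seqVar r (fun n => f (φ n)) ≤ seqVar r f :=
  seqVar_le_iff.2 fun _ u hu => le_seqVar r f (u := fun i => φ (u i)) (hφ.comp hu)

lemma seqVar_zero {r : ℝ} (hr : 0 < r) : seqVar r (fun _ => 0) = 0 := by
  refine le_antisymm (seqVar_le_iff.2 fun L u _ => ?_) zero_le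
  simp [hr]

lemma seqVar_sub_const (r : ℝ) (f : ℕ → ℝ) (c : ℝ) :
    seqVar r (fun n => f n - c) = seqVar r f := by
  simp [seqVar]

lemma seqVar_add_le {r : ℝ} (hr : 1 ≤ r) (f g : ℕ → ℝ) :
    seqVar r (fun n => f n + g n) ≤ seqVar r f + seqVar r g := by
  refine seqVar_le_iff.2 fun L u hu => ?_
  calc (∑ l : Fin L, (ENNReal.ofReal
          |f (u l.succ) + g (u l.succ) - (f (u l.castSucc) + g (u l.castSucc))|) ^ r) ^ (1 / r)
      ≤ (∑ l : Fin L, (ENNReal.ofReal |f (u l.succ) - f (u l.castSucc)|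
          + ENNReal.ofReal |g (u l.succ) - g (u l.castSucc)|) ^ r) ^ (1 / r) := by
        gcongr with l
        rw [← ENNReal.ofReal_add (abs_nonneg _) (abs_nonneg _)]
        refine ENNReal.ofReal_le_ofReal ?_
        rw [add_sub_add_comm]
        exact abs_add_le _ _
    _ ≤ _ := ENNReal.Lp_add_le _ _ _ hr
    _ ≤ _ := add_le_add (le_seqVar r f hu) (le_seqVar r g hu)

lemma seqVar_sum_le {r : ℝ} (hr : 1 ≤ r) {ι : Type*} (s : Finset ι) (f : ι → ℕ → ℝ) :
    seqVar r (fun n => ∑ i ∈ s, f i n) ≤ ∑ i ∈ s, seqVar r (f i) := by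
  classical
  induction s using Finset.induction_on with
  | empty => simp [seqVar_zero (zero_lt_one.trans_le hr)]
  | insert i s hi ih =>
    simp only [Finset.sum_insert hi]
    exact (seqVar_add_le hr _ _).trans (add_le_add le_rfl ih)

lemma seqVar_const_mul {r : ℝ} (hr : 0 < r) (c : ℝ) (f : ℕ → ℝ) :
    seqVar r (fun n => c * f n) = ENNReal.ofReal |c| * seqVar r f := by
  simp only [seqVar, ENNReal.mul_iSup]
  congr! 8 with L u hu
  simp only [← mul_sub, abs_mul, ENNReal.ofReal_mul (abs_nonneg c),
    ENNReal.mul_rpow_of_nonneg _ _ hr.le, ← Finset.mul_sum]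
  rw [ENNReal.mul_rpow_of_nonneg _ _ (by positivity), ← ENNReal.rpow_mul,
    mul_one_div_cancel hr.ne', ENNReal.rpow_one]

lemma sum_fin_telescope {ι : Type*} (D : ι → ℝ) (L : ℕ) (u : Fin (L + 1) → ι) :
    ∑ l : Fin L, (D (u l.succ) - D (u l.castSucc)) = D (u (Fin.last L)) - D (u 0) := by
  induction L with
  | zero => simp
  | succ L ih =>
    rw [Fin.sum_univ_castSucc]
    have := ih fun i => u i.castSucc
    simp only [Fin.succ_castSucc, Fin.castSucc_zero, Fin.succ_last] at this ⊢
    rw [this]; ring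

lemma seqVar_step_le {r : ℝ} (hr : 0 < r) (k : ℕ) (c : ℝ) :
    seqVar r (fun n => if k < n then c else 0) ≤ ENNReal.ofReal |c| := by
  refine seqVar_le_iff.2 fun L u hu => ?_
  rw [one_div, ENNReal.rpow_inv_le_iff hr]
  set χ : ℕ → ℝ := fun n => if k < n then 1 else 0
  have hχ : Monotone χ := by
    intro a b hab
    simp only [χ]
    split_ifs <;> first | omega | norm_num
  calc _ = ∑ l : Fin L, ENNReal.ofReal |c| ^ r * ENNReal.ofReal
          (χ (u l.succ) - χ (u l.castSucc)) := by
        refine Finset.sum_congr rfl fun l _ => ?_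
        have : u l.castSucc ≤ u l.succ := hu (Fin.castSucc_le_succ l)
        simp only [χ]
        split_ifs <;> first | omega | simp [hr]
    _ = ENNReal.ofReal |c| ^ r * ENNReal.ofReal (χ (u (Fin.last L)) - χ (u 0)) := by
        rw [← Finset.mul_sum, ← ENNReal.ofReal_sum_of_nonneg, sum_fin_telescope]
        exact fun l _ => sub_nonneg.2 (hχ (hu (Fin.castSucc_le_succ l)))
    _ ≤ ENNReal.ofReal |c| ^ r * ENNReal.ofReal 1 := by
        gcongr
        simp only [χ]
        split_ifs <;> norm_num
    _ = _ := by simp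

lemma sum_range_eq_sum_step (d : ℕ → ℝ) {N : ℕ} (hd : ∀ k, N ≤ k → d k = 0) (n : ℕ) :
    ∑ k ∈ Finset.range n, d k = ∑ k ∈ Finset.range N, if k < n then d k else 0 := by
  rw [← Finset.sum_filter]
  refine (Finset.sum_subset_zero_on_sdiff ?_ ?_ fun _ _ => rfl).symm
  · intro k; simp
  · intro k hk
    simp only [Finset.mem_sdiff, Finset.mem_range, Finset.mem_filter, not_and] at hk
    exact hd k (by by_contra! h; exact hk.2 h hk.1)

lemma seqVar_sum_range_le {r : ℝ} (hr : 1 ≤ r) (d : ℕ → ℝ) {N : ℕ}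
    (hd : ∀ k, N ≤ k → d k = 0) :
    seqVar r (fun n => ∑ k ∈ Finset.range n, d k)
      ≤ ∑ k ∈ Finset.range N, ENNReal.ofReal |d k| := by
  simp_rw [sum_range_eq_sum_step d hd]
  exact (seqVar_sum_le hr _ _).trans
    (Finset.sum_le_sum fun k _ => seqVar_step_le (zero_lt_one.trans_le hr) k _)

/-- Summation by parts: integrating a nonnegative increasing sequence against `h` multiplies the
variation by at most its final value. -/
lemma seqVar_mul_monotone_le {r : ℝ} (hr : 1 ≤ r) (M d : ℕ → ℝ) (hM : Monotone M)
    (hM0 : 0 ≤ M 0) {N : ℕ} (hd : ∀ k, N ≤ k → d k = 0) :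
    seqVar r (fun n => ∑ k ∈ Finset.range n, M k * d k)
      ≤ ENNReal.ofReal (M N) * seqVar r (fun n => ∑ k ∈ Finset.range n, d k) := by
  set h : ℕ → ℝ := fun n => ∑ k ∈ Finset.range n, d k
  have hk (n k : ℕ) : h (max n k) - h k = ∑ i ∈ Finset.range n, if k ≤ i then d i else 0 := by
    rw [← Finset.sum_filter]
    simp only [h]
    rw [Finset.sum_range_sub_sum_range (le_max_right _ _)]
    refine Finset.sum_congr ?_ fun _ _ => rfl
    ext i; simp only [Finset.mem_filter, Finset.mem_range]; omega
  have key (n : ℕ) : ∑ k ∈ Finset.range n, M k * d k = M 0 * h n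
      + ∑ k ∈ Finset.range N, (M (k + 1) - M k) * (h (max n (k + 1)) - h (k + 1)) := by
    simp_rw [hk, Finset.mul_sum, h, Finset.mul_sum]
    rw [Finset.sum_comm, ← Finset.sum_add_distrib]
    refine Finset.sum_congr rfl fun i _ => ?_
    by_cases hi : N ≤ i
    · simp [hd i hi]
    · have : ∑ k ∈ Finset.range N, (M (k + 1) - M k) * (if k + 1 ≤ i then d i else 0)
          = ∑ k ∈ Finset.range i, (M (k + 1) - M k) * d i := by
        simp only [mul_ite, mul_zero]
        rw [← Finset.sum_filter]
        refine Finset.sum_congr ?_ fun _ _ => rfl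
        ext k; simp only [Finset.mem_filter, Finset.mem_range]; omega
      rw [this, ← Finset.sum_mul, Finset.sum_range_sub]; ring
  have hr0 := zero_lt_one.trans_le hr
  simp_rw [key]
  calc _ ≤ seqVar r (fun n => M 0 * h n) + ∑ k ∈ Finset.range N,
          seqVar r (fun n => (M (k + 1) - M k) * (h (max n (k + 1)) - h (k + 1))) :=
        (seqVar_add_le hr _ _).trans (add_le_add le_rfl (seqVar_sum_le hr _ _))
    _ ≤ ENNReal.ofReal (M 0) * seqVar r h
        + ∑ k ∈ Finset.range N, ENNReal.ofReal (M (k + 1) - M k) * seqVar r h := by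
        gcongr with k
        · rw [seqVar_const_mul hr0, abs_of_nonneg hM0]
        · rw [seqVar_const_mul hr0, abs_of_nonneg (sub_nonneg.2 (hM (Nat.le_succ k))),
            seqVar_sub_const]
          gcongr
          exact seqVar_comp_le r h fun a b hab => max_le_max_right _ hab
    _ = _ := by
        rw [← Finset.sum_mul, ← add_mul, ← ENNReal.ofReal_sum_of_nonneg
          fun k _ => sub_nonneg.2 (hM (Nat.le_succ k)), Finset.sum_range_sub,
          ← ENNReal.ofReal_add hM0 (sub_nonneg.2 (hM (Nat.zero_le N)))]
        simp

/-- A sequence moving at no more than `#A` times has comparable variations of all orders. -/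
lemma seqVar_le_card_mul {r ρ : ℝ} (hr : 0 < r) (hρ : r ≤ ρ) (d : ℕ → ℝ) (A : Finset ℕ)
    (hd : ∀ k, k ∉ A → d k = 0) :
    seqVar r (fun n => ∑ k ∈ Finset.range n, d k)
      ≤ (A.card : ℝ≥0∞) ^ (1 / r - 1 / ρ) * seqVar ρ (fun n => ∑ k ∈ Finset.range n, d k) := by
  set h : ℕ → ℝ := fun n => ∑ k ∈ Finset.range n, d k with hh
  refine seqVar_le_iff.2 fun L u hu => ?_
  have hρ0 := hr.trans_le hρ
  set x : Fin L → ℝ≥0∞ := fun l => ENNReal.ofReal |h (u l.succ) - h (u l.castSucc)|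
  set B : Finset (Fin L) := {l | x l ≠ 0}
  have hB : B.card ≤ A.card := by
    set ν : ℕ → ℝ := fun n => ∑ k ∈ Finset.range n, if k ∈ A then (1 : ℝ) else 0 with hν
    have hν_mono : Monotone ν := by
      refine monotone_nat_of_le_succ fun n => ?_
      simp only [hν, Finset.sum_range_succ]
      split_ifs <;> norm_num
    have hνA (n : ℕ) : ν n ≤ A.card := by
      simp only [hν, ← Finset.sum_filter, Finset.sum_const, nsmul_eq_mul, mul_one]
      exact_mod_cast Finset.card_le_card fun k hk => (Finset.mem_filter.1 hk).2
    have h1 : ∀ l ∈ B, (1 : ℝ) ≤ ν (u l.succ) - ν (u l.castSucc) := by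
      intro l hl
      have hle : u l.castSucc ≤ u l.succ := hu (Fin.castSucc_le_succ l)
      have hl' : h (u l.succ) - h (u l.castSucc) ≠ 0 := by
        intro h0
        simp [B, x, h0] at hl
      simp only [hh, Finset.sum_range_sub_sum_range hle] at hl'
      obtain ⟨k, hk, hk0⟩ := Finset.exists_ne_zero_of_sum_ne_zero hl'
      have hkA : k ∈ A := by by_contra hkA; exact hk0 (hd k hkA)
      simp only [hν, Finset.sum_range_sub_sum_range hle]
      calc (1 : ℝ) = if k ∈ A then (1 : ℝ) else 0 := by simp [hkA]
        _ ≤ _ := Finset.single_le_sum (f := fun k => if k ∈ A then (1 : ℝ) else 0)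
          (fun i _ => by split_ifs <;> norm_num) hk
    have h2 : (B.card : ℝ) ≤ A.card := by
      calc (B.card : ℝ) = ∑ l ∈ B, (1 : ℝ) := by simp
        _ ≤ ∑ l ∈ B, (ν (u l.succ) - ν (u l.castSucc)) := Finset.sum_le_sum h1
        _ ≤ ∑ l : Fin L, (ν (u l.succ) - ν (u l.castSucc)) :=
          Finset.sum_le_sum_of_subset_of_nonneg (Finset.subset_univ _) fun l _ _ =>
            sub_nonneg.2 (hν_mono (hu (Fin.castSucc_le_succ l)))
        _ = ν (u (Fin.last L)) - ν (u 0) := sum_fin_telescope ν L u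
        _ ≤ A.card := by
          have := hνA (u (Fin.last L))
          have : 0 ≤ ν (u 0) := Finset.sum_nonneg fun i _ => by split_ifs <;> norm_num
          linarith
    exact_mod_cast h2
  have hsum (s : ℝ) (hs : 0 < s) : ∑ l, x l ^ s = ∑ l ∈ B, x l ^ s := by
    refine (Finset.sum_subset (Finset.subset_univ _) fun l _ hl => ?_).symm
    have : x l = 0 := by simpa [B] using hl
    simp [this, hs]
  refine le_trans ?_ (mul_le_mul_right (le_seqVar ρ h hu) _)
  change (∑ l, x l ^ r) ^ (1 / r) ≤ _ * (∑ l, x l ^ ρ) ^ (1 / ρ)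
  rw [hsum r hr, hsum ρ hρ0]
  rcases hρ.eq_or_lt with rfl | hlt
  · simp
  have hc : (ρ / r).HolderConjugate (ρ / (ρ - r)) := by
    rw [Real.holderConjugate_iff]
    refine ⟨(one_lt_div hr).2 hlt, ?_⟩
    have := sub_pos.2 hlt
    field_simp
    ring
  have hH := ENNReal.inner_le_Lp_mul_Lq B (fun l => x l ^ r) (fun _ => 1) hc
  simp only [mul_one, ENNReal.one_rpow, Finset.sum_const, nsmul_eq_mul, ← ENNReal.rpow_mul,
    mul_div_cancel₀ _ hr.ne'] at hH
  calc _ ≤ ((∑ l ∈ B, x l ^ ρ) ^ (1 / (ρ / r)) * (B.card : ℝ≥0∞) ^ (1 / (ρ / (ρ - r)))) ^ (1 / r) :=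
        ENNReal.rpow_le_rpow hH (by positivity)
    _ = (B.card : ℝ≥0∞) ^ (1 / r - 1 / ρ) * (∑ l ∈ B, x l ^ ρ) ^ (1 / ρ) := by
        rw [ENNReal.mul_rpow_of_nonneg _ _ (by positivity), ← ENNReal.rpow_mul,
          ← ENNReal.rpow_mul, mul_comm]
        congr 2 <;> field_simp
    _ ≤ _ := by
        gcongr
        exact sub_nonneg.2 (one_div_le_one_div_of_le hr hρ)

lemma measurable_seqVar {Ω : Type*} {m : MeasurableSpace Ω} (r : ℝ) {f : ℕ → Ω → ℝ}
    (hf : ∀ n, Measurable (f n)) : Measurable fun ω => seqVar r fun n => f n ω := by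
  unfold seqVar
  refine Measurable.iSup fun L => Measurable.iSup fun u => Measurable.iSup_Prop _ ?_
  refine Measurable.pow_const (Finset.measurable_sum _ fun l _ => ?_) _
  exact (((hf _).sub (hf _)).abs.ennreal_ofReal).pow_const _

/-- The running maximum of `|f|`. -/
def runMax (f : ℕ → ℝ) : ℕ → ℝ
  | 0 => |f 0|
  | n + 1 => max (runMax f n) |f (n + 1)|

lemma runMax_mono (f : ℕ → ℝ) : Monotone (runMax f) :=
  monotone_nat_of_le_succ fun _ => le_max_left _ _

lemma abs_le_runMax (f : ℕ → ℝ) : ∀ n, |f n| ≤ runMax f n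
  | 0 => le_rfl
  | _ + 1 => le_max_right _ _

lemma runMax_nonneg (f : ℕ → ℝ) (n : ℕ) : 0 ≤ runMax f n :=
  (abs_nonneg _).trans (abs_le_runMax f n)

lemma runMax_le {f : ℕ → ℝ} {n : ℕ} {A : ℝ} (h : ∀ k ≤ n, |f k| ≤ A) : runMax f n ≤ A := by
  induction n with
  | zero => exact h 0 le_rfl
  | succ n ih => exact max_le (ih fun k hk => h k (by omega)) (h _ le_rfl)

lemma davis_step {Z s s' y y' x D : ℝ} (hs : 0 ≤ s) (hs' : 0 ≤ s') (hy : 0 ≤ y) (hy' : 0 ≤ y')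
    (hsZ : s ≤ Z) (hyZ : y ≤ Z) (hx : |x| ≤ y) (hss : s' ^ 2 = s ^ 2 + D ^ 2)
    (hyy : y' ^ 2 = y ^ 2 + 2 * x * D + D ^ 2) :
    y' ^ 2 / max Z (max y' s') + max Z (max y' s')
      ≤ y ^ 2 / Z + Z + 2 * (x / Z * D) + 24 * (s' - s) := by
  have hZ : 0 ≤ Z := hs.trans hsZ
  have hle : s ≤ s' := by nlinarith [sq_nonneg D]
  have hDs : D ^ 2 ≤ 2 * s' * (s' - s) := by nlinarith
  set Z' := max Z (max y' s') with hZ'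
  have hZZ' : Z ≤ Z' := le_max_left _ _
  have hyZ : y' ≤ Z' := (le_max_left _ _).trans (le_max_right _ _)
  have hxD : -(|x| * |D|) ≤ x * D := by
    rw [← abs_mul]; exact neg_abs_le _
  have hxD' : x * D ≤ |x| * |D| := by
    rw [← abs_mul]; exact le_abs_self _
  have hD2 : |D| ^ 2 = D ^ 2 := sq_abs D
  rcases hZ.eq_or_lt with h0 | hZpos
  · have hy0 : y = 0 := by linarith
    have hs0 : s = 0 := by linarith
    have hx0 : x = 0 := by rw [hy0] at hx; exact abs_nonpos_iff.1 hx
    subst hy0 hs0 hx0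
    have : y' = s' := by nlinarith
    subst this
    have hm : Z' = y' := by rw [hZ', ← h0]; simp [hy']
    rw [hm, ← h0]
    rcases hy'.eq_or_lt with h | h
    · simp [← h]
    · have : y' ^ 2 / y' = y' := by field_simp
      rw [this]; simp; linarith
  rcases le_or_gt |D| Z with hDZ | hDZ
  · have hs'Z : s' ≤ 2 * Z := by nlinarith [abs_nonneg D]
    have hD4 : D ^ 2 / Z ≤ 4 * (s' - s) := by
      rw [div_le_iff₀ hZpos]; nlinarith
    have hexp : y' ^ 2 / Z = y ^ 2 / Z + 2 * (x / Z * D) + D ^ 2 / Z := by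
      rw [hyy]; field_simp
    suffices h : y' ^ 2 / Z' + Z' ≤ y' ^ 2 / Z + Z + (s' - s) by linarith
    have hZ'pos := hZpos.trans_le hZZ'
    have hφ : y' ^ 2 / Z + Z + (Z' - Z) * (1 - y' ^ 2 / (Z * Z')) = y' ^ 2 / Z' + Z' := by
      field_simp; ring
    rw [← hφ]
    have : (Z' - Z) * (1 - y' ^ 2 / (Z * Z')) ≤ s' - s := by
      rcases max_choice Z (max y' s') with h | h
      · rw [← hZ'] at h; rw [h]; simpa using hle
      rcases max_choice y' s' with h' | h'
      · have hh : Z' = y' := by rw [hZ', h, h']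
        have : 1 ≤ y' ^ 2 / (Z * Z') := by
          rw [one_le_div (by positivity), ← hh]; nlinarith
        nlinarith
      · have hh : Z' = s' := by rw [hZ', h, h']
        have : 0 ≤ y' ^ 2 / (Z * Z') := by positivity
        nlinarith
    linarith
  · have hs'D : s' ≤ 2 * |D| := by nlinarith [abs_nonneg D]
    have hy'D : y' ≤ 2 * |D| := by nlinarith [abs_nonneg D, abs_nonneg x]
    have hDpos := hZpos.trans hDZ
    have hD4 : |D| ≤ 4 * (s' - s) := by nlinarith
    have hZ'D : Z' ≤ 2 * |D| := max_le (by linarith) (max_le hy'D hs'D)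
    have hZ'pos := hZpos.trans_le hZZ'
    have h1 : y' ^ 2 / Z' ≤ Z' := by rw [div_le_iff₀ hZ'pos]; nlinarith
    have h2 : -|D| ≤ x / Z * D := by
      have : |x / Z * D| ≤ |D| := by
        rw [abs_mul, abs_div, abs_of_pos hZpos]
        have : |x| / Z ≤ 1 := by rw [div_le_one hZpos]; linarith
        nlinarith
      exact (neg_le_neg this).trans (neg_abs_le _)
    have h3 : 0 ≤ y ^ 2 / Z := by positivity
    linarith

/-- The running maximum of `√Y` and of the square function of `d`. -/
noncomputable def davisMax (d Y : ℕ → ℝ) : ℕ → ℝ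
  | 0 => 0
  | n + 1 => max (davisMax d Y n)
      (max √(Y (n + 1)) √(∑ k ∈ Finset.range (n + 1), d k ^ 2))

lemma davisMax_mono (d Y : ℕ → ℝ) : Monotone (davisMax d Y) :=
  monotone_nat_of_le_succ fun _ => le_max_left _ _

lemma davisMax_nonneg (d Y : ℕ → ℝ) (n : ℕ) : 0 ≤ davisMax d Y n :=
  davisMax_mono d Y (Nat.zero_le n)

lemma sqrt_le_davisMax {d Y : ℕ → ℝ} (hY : Y 0 = 0) : ∀ n, √(Y n) ≤ davisMax d Y n
  | 0 => by simp [hY, davisMax]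
  | _ + 1 => (le_max_left _ _).trans (le_max_right _ _)

lemma sqrt_sum_le_davisMax (d Y : ℕ → ℝ) :
    ∀ n, √(∑ k ∈ Finset.range n, d k ^ 2) ≤ davisMax d Y n
  | 0 => by simp [davisMax]
  | _ + 1 => (le_max_right _ _).trans (le_max_right _ _)

/-- Pathwise Davis inequality. -/
lemma davisMax_le {d Y x : ℕ → ℝ} (hY0 : Y 0 = 0)
    (hY : ∀ n, Y (n + 1) = Y n + 2 * x n * d n + d n ^ 2) (hx : ∀ n, x n ^ 2 ≤ Y n) (N : ℕ) :
    davisMax d Y N ≤ 2 * ∑ n ∈ Finset.range N, x n / davisMax d Y n * d n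
      + 24 * √(∑ k ∈ Finset.range N, d k ^ 2) := by
  have hYnn (n : ℕ) : 0 ≤ Y n := (sq_nonneg _).trans (hx n)
  suffices h : √(Y N) ^ 2 / davisMax d Y N + davisMax d Y N
      ≤ 2 * ∑ n ∈ Finset.range N, x n / davisMax d Y n * d n
      + 24 * √(∑ k ∈ Finset.range N, d k ^ 2) by
    have : 0 ≤ √(Y N) ^ 2 / davisMax d Y N := div_nonneg (sq_nonneg _) (davisMax_nonneg d Y N)
    linarith
  induction N with
  | zero => simp [davisMax]
  | succ N ih =>
    have hsq (n : ℕ) : 0 ≤ ∑ k ∈ Finset.range n, d k ^ 2 :=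
      Finset.sum_nonneg fun _ _ => sq_nonneg _
    have := davis_step (Z := davisMax d Y N) (x := x N) (D := d N) (Real.sqrt_nonneg _)
      (Real.sqrt_nonneg (∑ k ∈ Finset.range (N + 1), d k ^ 2)) (Real.sqrt_nonneg (Y N))
      (Real.sqrt_nonneg (Y (N + 1))) (sqrt_sum_le_davisMax d Y N) (sqrt_le_davisMax hY0 N)
      (Real.abs_le_sqrt (hx N))
      (by rw [Real.sq_sqrt (hsq _), Real.sq_sqrt (hsq _), Finset.sum_range_succ])
      (by rw [Real.sq_sqrt (hYnn _), Real.sq_sqrt (hYnn _), hY])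
    rw [Finset.sum_range_succ (fun n => x n / davisMax d Y n * d n)]
    change _ / davisMax d Y (N + 1) + davisMax d Y (N + 1) ≤ _ at this
    linarith

/-- The value of `f` at the last time it moved by at least `ε` times its running maximum. -/
noncomputable def anchor (ε : ℝ) (f : ℕ → ℝ) : ℕ → ℝ
  | 0 => f 0
  | n + 1 => if ε * runMax f (n + 1) ≤ |f (n + 1) - anchor ε f n| then f (n + 1)
      else anchor ε f n

/-- The sum of the squares of the completed moves of `anchor`. -/
noncomputable def anchorSq (ε : ℝ) (f : ℕ → ℝ) : ℕ → ℝ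
  | 0 => 0
  | n + 1 => anchorSq ε f n + (anchor ε f (n + 1) - anchor ε f n) ^ 2

lemma anchorSq_mono (ε : ℝ) (f : ℕ → ℝ) : Monotone (anchorSq ε f) :=
  monotone_nat_of_le_succ fun _ => le_add_of_nonneg_right (sq_nonneg _)

lemma anchorSq_nonneg (ε : ℝ) (f : ℕ → ℝ) (n : ℕ) : 0 ≤ anchorSq ε f n :=
  anchorSq_mono ε f (Nat.zero_le n)

lemma abs_sub_anchor_le {ε : ℝ} (hε : 0 ≤ ε) (f : ℕ → ℝ) :
    ∀ n, |f n - anchor ε f n| ≤ ε * runMax f n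
  | 0 => by simpa [anchor] using mul_nonneg hε (runMax_nonneg f 0)
  | n + 1 => by
    simp only [anchor]
    split_ifs with h
    · simpa using mul_nonneg hε (runMax_nonneg f (n + 1))
    · exact (not_le.1 h).le

lemma abs_anchor_le (ε : ℝ) (f : ℕ → ℝ) : ∀ n, |anchor ε f n| ≤ runMax f n
  | 0 => le_rfl
  | n + 1 => by
    simp only [anchor]
    split_ifs
    · exact abs_le_runMax f (n + 1)
    · exact (abs_anchor_le ε f n).trans (runMax_mono f n.le_succ)

lemma anchorSq_add_sq_succ (ε : ℝ) (f : ℕ → ℝ) (n : ℕ) :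
    anchorSq ε f (n + 1) + (f (n + 1) - anchor ε f (n + 1)) ^ 2
      = anchorSq ε f n + (f (n + 1) - anchor ε f n) ^ 2 := by
  simp only [anchorSq, anchor]
  split_ifs <;> ring

lemma anchor_eq_or_le {ε : ℝ} (hε : 0 ≤ ε) (hε' : ε ≤ 1 / 2) (f : ℕ → ℝ) {s t : ℕ}
    (hst : s ≤ t) :
    anchor ε f t = anchor ε f s
      ∨ (ε * runMax f t / 2) ^ 2 ≤ anchorSq ε f t - anchorSq ε f s := by
  have key : ∃ H, 0 ≤ H ∧ |anchor ε f t| ≤ H ∧ runMax f t ≤ H + ε * runMax f t ∧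
      (anchor ε f t = anchor ε f s ∨ (ε * H) ^ 2 ≤ anchorSq ε f t - anchorSq ε f s) := by
    induction t, hst using Nat.le_induction with
    | base =>
      exact ⟨runMax f s, runMax_nonneg f s, abs_anchor_le ε f s,
        le_add_of_nonneg_right (mul_nonneg hε (runMax_nonneg f s)), Or.inl rfl⟩
    | succ t hst ih =>
      obtain ⟨H, hH0, hH1, hH2, hH3⟩ := ih
      by_cases h : ε * runMax f (t + 1) ≤ |f (t + 1) - anchor ε f t|
      · refine ⟨runMax f (t + 1), runMax_nonneg _ _, abs_anchor_le ε f _,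
          le_add_of_nonneg_right (mul_nonneg hε (runMax_nonneg f _)), Or.inr ?_⟩
        have h1 := anchorSq_mono ε f hst
        simp only [anchorSq, anchor, if_pos h]
        have h2 : (ε * runMax f (t + 1)) ^ 2 ≤ (f (t + 1) - anchor ε f t) ^ 2 := by
          rw [← sq_abs (f (t + 1) - _)]
          exact pow_le_pow_left₀ (mul_nonneg hε (runMax_nonneg f _)) h 2
        linarith
      · have ha : anchor ε f (t + 1) = anchor ε f t := by simp only [anchor, if_neg h]
        have hS : anchorSq ε f (t + 1) = anchorSq ε f t := by simp [anchorSq, ha]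
        rw [ha, hS]
        refine ⟨H, hH0, hH1, max_le ?_ ?_, hH3⟩
        · have := mul_le_mul_of_nonneg_left (runMax_mono f t.le_succ) hε
          exact hH2.trans (by gcongr)
        · have h1 := abs_sub_abs_le_abs_sub (f (t + 1)) (anchor ε f t)
          linarith [not_le.1 h]
  obtain ⟨H, hH0, -, hH2, hH3⟩ := key
  refine hH3.imp id fun h => le_trans ?_ h
  have : runMax f t / 2 ≤ H := by nlinarith [runMax_nonneg f t]
  have h0 := runMax_nonneg f t
  refine pow_le_pow_left₀ (by positivity) ?_ 2
  rw [mul_div_assoc]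
  exact mul_le_mul_of_nonneg_left this hε

/-- Every increment is captured by the completed moves at some dyadic relative scale. -/
lemma exists_scale_sq_le (f : ℕ → ℝ) {s t : ℕ} (hst : s ≤ t) (hne : f t ≠ f s) :
    ∃ m : ℕ, |f t - f s| ≤ 4 * (1 / 2) ^ (m + 1) * runMax f t ∧
      |f t - f s| ^ 2 ≤ 64 * (anchorSq ((1 / 2) ^ (m + 1)) f t
        - anchorSq ((1 / 2) ^ (m + 1)) f s) := by
  have hx : 0 < |f t - f s| := abs_pos.2 (sub_ne_zero.2 hne)
  have hle : |f t - f s| ≤ 2 * runMax f t := by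
    have := abs_sub (f t) (f s)
    have h1 := abs_le_runMax f t
    have h2 := (abs_le_runMax f s).trans (runMax_mono f hst)
    linarith
  have hR : 0 < runMax f t := by linarith
  obtain ⟨m, hm1, hm2⟩ := exists_nat_pow_near_of_lt_one
    (x := |f t - f s| / (2 * runMax f t)) (y := (1 / 2 : ℝ)) (by positivity)
    (by rw [div_le_one (by positivity)]; exact hle) (by norm_num) (by norm_num)
  rw [lt_div_iff₀ (by positivity)] at hm1
  rw [div_le_iff₀ (by positivity)] at hm2
  have h4 : |f t - f s| ≤ 4 * (1 / 2) ^ (m + 1) * runMax f t := by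
    rw [pow_succ]; linarith
  refine ⟨m, h4, ?_⟩
  set ε : ℝ := (1 / 2) ^ (m + 1) with hεdef
  have hε : 0 ≤ ε := by positivity
  have hε' : ε ≤ 1 / 2 := by
    rw [hεdef, pow_succ]
    have : (1 / 2 : ℝ) ^ m ≤ 1 := pow_le_one₀ (by norm_num) (by norm_num)
    linarith
  rcases anchor_eq_or_le hε hε' f hst with h | h
  · exfalso
    have h1 := abs_sub_anchor_le hε f t
    have h2 := abs_sub_anchor_le hε f s
    have h3 := mul_le_mul_of_nonneg_left (runMax_mono f hst) hε
    rw [h] at h1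
    have := abs_sub_le (f t) (anchor ε f s) (f s)
    rw [abs_sub_comm (anchor ε f s)] at this
    linarith
  · have : |f t - f s| ^ 2 ≤ (4 * ε * runMax f t) ^ 2 := pow_le_pow_left₀ hx.le h4 2
    nlinarith

/-- Pathwise Lépingle inequality: variation of order `ρ > 2` is controlled by the running maximum
and the moves at all dyadic relative scales. -/
lemma exists_seqVar_le_scales {ρ : ℝ} (hρ : 2 < ρ) :
    ∃ c : ℝ, 0 < c ∧ c < 1 ∧ ∃ K : ℝ≥0∞, K < ∞ ∧ ∀ (f : ℕ → ℝ) (N : ℕ) (T : ℝ≥0∞),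
      (∀ n, N ≤ n → f n = f N) → ENNReal.ofReal (runMax f N) ≤ T →
      (∀ m : ℕ, ENNReal.ofReal c ^ m *
        ENNReal.ofReal √(anchorSq ((1 / 2) ^ (m + 1)) f N) ≤ T) →
      seqVar ρ f ≤ K * T := by
  set c : ℝ := (1 / 2) ^ ((ρ - 2) / 4) with hc
  have hc0 : 0 < c := by positivity
  have hc1 : c < 1 := Real.rpow_lt_one (by norm_num) (by norm_num) (by linarith)
  set C := ENNReal.ofReal c with hC
  have hC1 : C < 1 := by
    rw [hC, ← ENNReal.ofReal_one]
    exact ENNReal.ofReal_lt_ofReal_iff'.2 ⟨hc1, by norm_num⟩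
  set A : ℝ≥0∞ := 64 * 4 ^ (ρ - 2) with hA
  have hAtop : A < ∞ := by
    rw [hA]
    exact ENNReal.mul_lt_top (by norm_num) (ENNReal.rpow_lt_top_of_nonneg (by linarith) (by norm_num))
  refine ⟨c, hc0, hc1, (A * (1 - C ^ 2)⁻¹) ^ (1 / ρ), ?_, fun f N T hfN hT hm => ?_⟩
  · refine ENNReal.rpow_lt_top_of_nonneg (by positivity) (ENNReal.mul_ne_top hAtop.ne ?_)
    rw [ENNReal.inv_ne_top]
    exact (tsub_pos_of_lt (pow_lt_one₀ zero_le hC1 (by norm_num))).ne'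
  set W : ℕ → ℕ → ℝ := fun m => anchorSq ((1 / 2) ^ (m + 1)) f with hW
  refine seqVar_le_iff.2 fun L u hu => ?_
  have hρ0 : 0 < ρ := by linarith
  set v : Fin (L + 1) → ℕ := fun i => min (u i) N
  have hv : Monotone v := fun a b hab => min_le_min_right _ (hu hab)
  have hfv (i : Fin (L + 1)) : f (u i) = f (v i) := by
    rcases le_total (u i) N with h | h
    · simp [v, h]
    · simp [v, h, hfN _ h]
  have hterm (l : Fin L) : ENNReal.ofReal |f (u l.succ) - f (u l.castSucc)| ^ ρ
      ≤ ∑' m : ℕ, A * C ^ (4 * m) * T ^ (ρ - 2)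
        * ENNReal.ofReal (W m (v l.succ) - W m (v l.castSucc)) := by
    rw [hfv, hfv]
    have hle : v l.castSucc ≤ v l.succ := hv (Fin.castSucc_le_succ l)
    by_cases hne : f (v l.succ) = f (v l.castSucc)
    · simp [hne, hρ0]
    obtain ⟨m, h1, h2⟩ := exists_scale_sq_le f hle hne
    refine le_trans ?_ (ENNReal.le_tsum m)
    set X := |f (v l.succ) - f (v l.castSucc)| with hX
    have hXρ : ENNReal.ofReal X ^ ρ = ENNReal.ofReal X ^ (ρ - 2) * ENNReal.ofReal X ^ (2 : ℝ) := by
      rw [← ENNReal.rpow_add_of_nonneg _ _ (by linarith) (by norm_num)]; congr 1; ring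
    have hs : ENNReal.ofReal X ^ (2 : ℝ)
        ≤ 64 * ENNReal.ofReal (W m (v l.succ) - W m (v l.castSucc)) := by
      rw [ENNReal.rpow_two, ← ENNReal.ofReal_pow (abs_nonneg _)]
      refine (ENNReal.ofReal_le_ofReal h2).trans ?_
      rw [ENNReal.ofReal_mul (by norm_num)]
      norm_num
      rfl
    have hc4 : ENNReal.ofReal ((1 / 2) ^ m) ^ (ρ - 2) = C ^ (4 * m) := by
      rw [ENNReal.ofReal_rpow_of_nonneg (by positivity) (by linarith), hC,
        ← ENNReal.ofReal_pow hc0.le, hc]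
      congr 1
      rw [← Real.rpow_natCast, ← Real.rpow_natCast, ← Real.rpow_mul (by norm_num),
        ← Real.rpow_mul (by norm_num)]
      congr 1
      push_cast; ring
    have hb : ENNReal.ofReal X ^ (ρ - 2) ≤ 4 ^ (ρ - 2) * C ^ (4 * m) * T ^ (ρ - 2) := by
      rw [← hc4, ← ENNReal.mul_rpow_of_nonneg _ _ (by linarith),
        ← ENNReal.mul_rpow_of_nonneg _ _ (by linarith)]
      refine ENNReal.rpow_le_rpow ?_ (by linarith)
      have hR := runMax_nonneg f (v l.succ)
      calc ENNReal.ofReal X ≤ ENNReal.ofReal (4 * (1 / 2) ^ m * runMax f N) := by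
            refine ENNReal.ofReal_le_ofReal (h1.trans ?_)
            exact mul_le_mul (mul_le_mul_of_nonneg_left
              (pow_le_pow_of_le_one (by norm_num) (by norm_num) m.le_succ) (by norm_num))
              (runMax_mono f (min_le_right _ _)) hR (by positivity)
        _ = 4 * ENNReal.ofReal ((1 / 2) ^ m) * ENNReal.ofReal (runMax f N) := by
            rw [ENNReal.ofReal_mul (by positivity), ENNReal.ofReal_mul (by norm_num)]
            norm_num
        _ ≤ _ := by gcongr
    calc _ ≤ (4 ^ (ρ - 2) * C ^ (4 * m) * T ^ (ρ - 2))
          * (64 * ENNReal.ofReal (W m (v l.succ) - W m (v l.castSucc))) := by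
          rw [hXρ]; exact mul_le_mul' hb hs
      _ = _ := by rw [hA]; ring
  have hWm (m : ℕ) : C ^ (2 * m) * ENNReal.ofReal (W m N) ≤ T ^ 2 := by
    have h := pow_le_pow_left₀ zero_le (hm m) 2
    rw [mul_pow, ← pow_mul, mul_comm m 2, ← ENNReal.ofReal_pow (Real.sqrt_nonneg _),
      Real.sq_sqrt (anchorSq_nonneg _ f N)] at h
    exact h
  have hmain : ∑ l : Fin L, ENNReal.ofReal |f (u l.succ) - f (u l.castSucc)| ^ ρ
      ≤ A * (1 - C ^ 2)⁻¹ * T ^ ρ := by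
    calc _ ≤ ∑ l : Fin L, ∑' m : ℕ, A * C ^ (4 * m) * T ^ (ρ - 2)
            * ENNReal.ofReal (W m (v l.succ) - W m (v l.castSucc)) :=
          Finset.sum_le_sum fun l _ => hterm l
      _ = ∑' m : ℕ, A * C ^ (4 * m) * T ^ (ρ - 2)
            * ∑ l : Fin L, ENNReal.ofReal (W m (v l.succ) - W m (v l.castSucc)) := by
          rw [← Summable.tsum_finsetSum fun _ _ => ENNReal.summable]
          simp_rw [Finset.mul_sum]
      _ ≤ ∑' m : ℕ, A * T ^ (ρ - 2) * T ^ 2 * (C ^ 2) ^ m := by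
          refine ENNReal.tsum_le_tsum fun m => ?_
          have h1 : ∑ l : Fin L, ENNReal.ofReal (W m (v l.succ) - W m (v l.castSucc))
              ≤ ENNReal.ofReal (W m N) := by
            rw [← ENNReal.ofReal_sum_of_nonneg fun l _ =>
              sub_nonneg.2 (anchorSq_mono _ f (hv (Fin.castSucc_le_succ l))), sum_fin_telescope]
            refine ENNReal.ofReal_le_ofReal ?_
            have h1 := anchorSq_nonneg ((1 / 2) ^ (m + 1)) f (v 0)
            have h2 := anchorSq_mono ((1 / 2) ^ (m + 1)) f (min_le_right (u (Fin.last L)) N)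
            simp only [hW, v] at *
            linarith
          calc _ ≤ A * C ^ (4 * m) * T ^ (ρ - 2) * ENNReal.ofReal (W m N) := by gcongr
            _ = A * T ^ (ρ - 2) * (C ^ (2 * m) * ENNReal.ofReal (W m N)) * (C ^ 2) ^ m := by
                rw [← pow_mul, show 4 * m = 2 * m + 2 * m by ring, pow_add]; ring
            _ ≤ _ := by gcongr; exact hWm m
      _ = A * (1 - C ^ 2)⁻¹ * T ^ ρ := by
          rw [ENNReal.tsum_mul_left, ENNReal.tsum_geometric]
          have : T ^ ρ = T ^ (ρ - 2) * T ^ 2 := by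
            rw [← ENNReal.rpow_two, ← ENNReal.rpow_add_of_nonneg _ _ (by linarith) (by norm_num)]
            congr 1; ring
          rw [this]; ring
  calc _ ≤ (A * (1 - C ^ 2)⁻¹ * T ^ ρ) ^ (1 / ρ) := ENNReal.rpow_le_rpow hmain (by positivity)
    _ = _ := by
      rw [ENNReal.mul_rpow_of_nonneg _ _ (by positivity), ← ENNReal.rpow_mul,
        mul_one_div_cancel hρ0.ne', ENNReal.rpow_one]

/-- A sequence of integrable random variables with `d k` measurable at time `k + 1` and orthogonal
to all bounded random variables measurable at time `k`. -/
structure IsMartingaleDiff {Ω : Type*} {mΩ : MeasurableSpace Ω} (μ : Measure Ω)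
    (G : Filtration ℕ mΩ) (d : ℕ → Ω → ℝ) : Prop where
  meas : ∀ k, Measurable[G (k + 1)] (d k)
  integrable : ∀ k, Integrable (d k) μ
  integral_mul : ∀ k (c : Ω → ℝ), Measurable[G k] c → (∀ ω, |c ω| ≤ 1) →
    ∫ ω, c ω * d k ω ∂μ = 0

/-- The square function of the first `N` terms. -/
noncomputable def sqFun {Ω : Type*} (d : ℕ → Ω → ℝ) (N : ℕ) (ω : Ω) : ℝ :=
  √(∑ k ∈ Finset.range N, d k ω ^ 2)

lemma sqFun_nonneg {Ω : Type*} (d : ℕ → Ω → ℝ) (N : ℕ) (ω : Ω) : 0 ≤ sqFun d N ω :=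
  Real.sqrt_nonneg _

section
variable {Ω : Type*} {mΩ : MeasurableSpace Ω} {μ : Measure Ω} {G : Filtration ℕ mΩ}
  {d : ℕ → Ω → ℝ}

lemma IsMartingaleDiff.mul (hd : IsMartingaleDiff μ G d) {b : ℕ → Ω → ℝ}
    (hb : ∀ k, Measurable[G k] (b k)) (hb1 : ∀ k ω, |b k ω| ≤ 1) :
    IsMartingaleDiff μ G fun k ω => b k ω * d k ω where
  meas k := ((hb k).mono (G.mono k.le_succ) le_rfl).mul (hd.meas k)
  integrable k := by
    refine (hd.integrable k).bdd_mul (c := 1) ?_ ?_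
    · exact ((hb k).mono (G.le k) le_rfl).aestronglyMeasurable
    · exact Eventually.of_forall fun ω => by simpa using hb1 k ω
  integral_mul k c hc hc1 := by
    simp_rw [← mul_assoc]
    refine hd.integral_mul k (fun ω => c ω * b k ω) (hc.mul (hb k)) fun ω => ?_
    rw [abs_mul]
    exact mul_le_one₀ (hc1 ω) (abs_nonneg _) (hb1 k ω)

lemma IsMartingaleDiff.measurable_sum (hd : IsMartingaleDiff μ G d) (n : ℕ) :
    Measurable[G n] fun ω => ∑ k ∈ Finset.range n, d k ω :=
  Finset.measurable_fun_sum _ fun k hk =>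
    (hd.meas k).mono (G.mono (Finset.mem_range.1 hk)) le_rfl

lemma IsMartingaleDiff.measurable_sqFun (hd : IsMartingaleDiff μ G d) (n : ℕ) :
    Measurable[G n] (sqFun d n) := by
  refine Measurable.sqrt (m := G n) (Finset.measurable_fun_sum _ fun k hk => ?_)
  exact ((hd.meas k).mono (G.mono (Finset.mem_range.1 hk)) le_rfl).pow_const 2

lemma abs_le_sqFun {k N : ℕ} (hk : k < N) (ω : Ω) : |d k ω| ≤ sqFun d N ω := by
  refine Real.abs_le_sqrt ?_
  exact Finset.single_le_sum (f := fun k => d k ω ^ 2) (fun _ _ => sq_nonneg _)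
    (Finset.mem_range.2 hk)

lemma sqFun_le_sum_abs (N : ℕ) (ω : Ω) : sqFun d N ω ≤ ∑ k ∈ Finset.range N, |d k ω| := by
  refine Real.sqrt_le_iff.2 ⟨Finset.sum_nonneg fun _ _ => abs_nonneg _, ?_⟩
  simp_rw [← sq_abs (d _ ω)]
  exact Finset.sum_sq_le_sq_sum_of_nonneg fun _ _ => abs_nonneg _

lemma IsMartingaleDiff.integrable_sqFun (hd : IsMartingaleDiff μ G d) (N : ℕ) :
    Integrable (sqFun d N) μ := by
  refine (integrable_finsetSum (Finset.range N) fun k _ => (hd.integrable k).abs).mono'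
    ((hd.measurable_sqFun N).mono (G.le N) le_rfl).aestronglyMeasurable
    (Eventually.of_forall fun ω => ?_)
  rw [Real.norm_of_nonneg (sqFun_nonneg d N ω)]
  exact sqFun_le_sum_abs N ω

lemma IsMartingaleDiff.measurable_davisMax (hd : IsMartingaleDiff μ G d) {Y : ℕ → Ω → ℝ}
    (hY : ∀ n, Measurable[G n] (Y n)) :
    ∀ n, Measurable[G n] fun ω => davisMax (fun k => d k ω) (fun k => Y k ω) n
  | 0 => measurable_const
  | n + 1 => by
    have h1 := (hd.measurable_davisMax hY n).mono (G.mono n.le_succ) le_rfl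
    exact h1.max ((hY (n + 1)).sqrt.max (hd.measurable_sqFun (n + 1)))

/-- Davis inequality for quadratic processes driven by a martingale. -/
lemma IsMartingaleDiff.lintegral_davisMax_le (hd : IsMartingaleDiff μ G d) {x Y : ℕ → Ω → ℝ}
    (hYm : ∀ n, Measurable[G n] (Y n)) (hxm : ∀ n, Measurable[G n] (x n))
    (hY0 : ∀ ω, Y 0 ω = 0)
    (hY : ∀ n ω, Y (n + 1) ω = Y n ω + 2 * x n ω * d n ω + d n ω ^ 2)
    (hx : ∀ n ω, x n ω ^ 2 ≤ Y n ω) (N : ℕ) :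
    ∫⁻ ω, ENNReal.ofReal (davisMax (fun k => d k ω) (fun k => Y k ω) N) ∂μ
      ≤ 24 * ∫⁻ ω, ENNReal.ofReal (sqFun d N ω) ∂μ := by
  set Z : ℕ → Ω → ℝ := fun n ω => davisMax (fun k => d k ω) (fun k => Y k ω) n
  have hZ := hd.measurable_davisMax hYm
  have hc1 (n : ℕ) (ω : Ω) : |x n ω / Z n ω| ≤ 1 := by
    rw [abs_div, abs_of_nonneg (davisMax_nonneg _ _ n)]
    refine div_le_one_of_le₀ ?_ (davisMax_nonneg _ _ n)
    exact (Real.abs_le_sqrt (hx n ω)).trans (sqrt_le_davisMax (Y := fun k => Y k ω) (hY0 ω) n)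
  have hcd := hd.mul (b := fun n ω => x n ω / Z n ω) (fun n => (hxm n).div (hZ n)) hc1
  have hle (ω : Ω) := davisMax_le (d := fun k => d k ω) (Y := fun k => Y k ω)
    (x := fun k => x k ω) (hY0 ω) (fun n => hY n ω) (fun n => hx n ω) N
  have hint : Integrable (fun ω => 2 * ∑ n ∈ Finset.range N, x n ω / Z n ω * d n ω
      + 24 * sqFun d N ω) μ :=
    ((integrable_finsetSum _ fun k _ => hcd.integrable k).const_mul 2).add
      ((hd.integrable_sqFun N).const_mul 24)
  have hZint : Integrable (Z N) μ := by
    refine hint.mono' ((hZ N).mono (G.le N) le_rfl).aestronglyMeasurable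
      (Eventually.of_forall fun ω => ?_)
    rw [Real.norm_of_nonneg (davisMax_nonneg _ _ N)]
    exact hle ω
  rw [← ofReal_integral_eq_lintegral_ofReal hZint
      (Eventually.of_forall fun ω => davisMax_nonneg _ _ N),
    ← ofReal_integral_eq_lintegral_ofReal (hd.integrable_sqFun N)
      (Eventually.of_forall fun ω => sqFun_nonneg d N ω),
    ← show ENNReal.ofReal 24 = 24 by norm_num, ← ENNReal.ofReal_mul (by norm_num)]
  refine ENNReal.ofReal_le_ofReal ((integral_mono hZint hint hle).trans_eq ?_)
  rw [integral_add ((integrable_finsetSum _ fun k _ => hcd.integrable k).const_mul 2)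
      ((hd.integrable_sqFun N).const_mul 24), integral_const_mul, integral_const_mul,
    integral_finsetSum _ fun k _ => hcd.integrable k]
  have h0 (k : ℕ) : ∫ ω, x k ω / Z k ω * d k ω ∂μ = 0 := by
    have := hcd.integral_mul k (fun _ => 1) measurable_const (by simp)
    simpa using this
  simp [h0]
end

lemma IsMartingaleDiff.measurable_anchor {Ω : Type*} {mΩ : MeasurableSpace Ω} {μ : Measure Ω}
    {G : Filtration ℕ mΩ} {d : ℕ → Ω → ℝ} (hd : IsMartingaleDiff μ G d) (ε : ℝ) (n : ℕ) :
    Measurable[G n] (fun ω => runMax (fun n => ∑ k ∈ Finset.range n, d k ω) n) ∧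
    Measurable[G n] (fun ω => anchor ε (fun n => ∑ k ∈ Finset.range n, d k ω) n) ∧
    Measurable[G n] (fun ω => anchorSq ε (fun n => ∑ k ∈ Finset.range n, d k ω) n) := by
  induction n with
  | zero => simp [runMax, anchor, anchorSq]
  | succ n ih =>
    obtain ⟨h1, h2, h3⟩ := ih
    replace h1 := h1.mono (G.mono n.le_succ) le_rfl
    replace h2 := h2.mono (G.mono n.le_succ) le_rfl
    replace h3 := h3.mono (G.mono n.le_succ) le_rfl
    have hf := hd.measurable_sum (n + 1)
    have hfa : Measurable[G (n + 1)] fun ω => |∑ k ∈ Finset.range (n + 1), d k ω| :=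
      measurable_norm.comp hf
    have h1' := h1.max hfa
    have hda : Measurable[G (n + 1)] fun ω => |∑ k ∈ Finset.range (n + 1), d k ω
        - anchor ε (fun n => ∑ k ∈ Finset.range n, d k ω) n| :=
      measurable_norm.comp (hf.sub h2)
    have hs := measurableSet_le (h1'.const_mul ε) hda
    have h2' := @Measurable.ite _ _ _ _ _ _ _ (fun _ => inferInstance) hs hf h2
    exact ⟨h1', h2', h3.add ((h2'.sub h2).pow_const 2)⟩

/-- The `L¹` variational Davis inequality. -/
lemma exists_lintegral_seqVar_le {ρ : ℝ} (hρ : 2 < ρ) :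
    ∃ C : ℝ≥0∞, C < ∞ ∧ ∀ (Ω : Type) (mΩ : MeasurableSpace Ω) (μ : Measure Ω)
      (G : Filtration ℕ mΩ) (d : ℕ → Ω → ℝ) (N : ℕ), IsMartingaleDiff μ G d →
      (∀ k, N ≤ k → ∀ ω, d k ω = 0) →
      ∫⁻ ω, seqVar ρ (fun n => ∑ k ∈ Finset.range n, d k ω) ∂μ
        ≤ C * ∫⁻ ω, ENNReal.ofReal (sqFun d N ω) ∂μ := by
  obtain ⟨c, hc0, hc1, K, hK, H⟩ := exists_seqVar_le_scales hρ
  have hC1 : ENNReal.ofReal c < 1 := by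
    rw [← ENNReal.ofReal_one]; exact ENNReal.ofReal_lt_ofReal_iff'.2 ⟨hc1, by norm_num⟩
  refine ⟨K * (24 + (1 - ENNReal.ofReal c)⁻¹ * 24), ?_, fun Ω mΩ μ G d N hd hN => ?_⟩
  · refine ENNReal.mul_lt_top hK (ENNReal.add_lt_top.2 ⟨by norm_num, ENNReal.mul_lt_top ?_ (by norm_num)⟩)
    rw [lt_top_iff_ne_top, ENNReal.inv_ne_top]
    exact (tsub_pos_of_lt hC1).ne'
  set f : Ω → ℕ → ℝ := fun ω n => ∑ k ∈ Finset.range n, d k ω with hf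
  have hfsucc (ω : Ω) (n : ℕ) : f ω (n + 1) = f ω n + d n ω := Finset.sum_range_succ _ _
  have hfm (n : ℕ) : Measurable[G n] fun ω => f ω n := hd.measurable_sum n
  set Y : ℕ → ℕ → Ω → ℝ := fun m n ω => anchorSq ((1 / 2) ^ (m + 1)) (f ω) n
    + (f ω n - anchor ((1 / 2) ^ (m + 1)) (f ω) n) ^ 2 with hY
  set Z₀ : Ω → ℝ := fun ω => davisMax (fun k => d k ω) (fun k => f ω k ^ 2) N
  set Z : ℕ → Ω → ℝ := fun m ω => davisMax (fun k => d k ω) (fun k => Y m k ω) N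
  have hYm (m n : ℕ) : Measurable[G n] (Y m n) := by
    obtain ⟨-, h2, h3⟩ := hd.measurable_anchor ((1 / 2) ^ (m + 1)) n
    exact h3.add (((hfm n).sub h2).pow_const 2)
  have hZ₀ := hd.lintegral_davisMax_le (x := fun n ω => f ω n) (Y := fun n ω => f ω n ^ 2)
    (fun n => (hfm n).pow_const 2) hfm (by simp [hf]) (fun n ω => by rw [hfsucc]; ring)
    (fun n ω => le_rfl) N
  have hZ (m : ℕ) := hd.lintegral_davisMax_le
    (x := fun n ω => f ω n - anchor ((1 / 2) ^ (m + 1)) (f ω) n) (Y := Y m) (hYm m)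
    (fun n => (hfm n).sub (hd.measurable_anchor _ n).2.1) (by simp [hY, anchorSq, anchor])
    (fun n ω => by simp only [hY, anchorSq_add_sq_succ, hfsucc]; ring)
    (fun n ω => le_add_of_nonneg_left (anchorSq_nonneg _ _ _)) N
  have hZm (m : ℕ) : Measurable (Z m) :=
    (hd.measurable_davisMax (hYm m) N).mono (G.le N) le_rfl
  have hZ₀m : Measurable Z₀ := (hd.measurable_davisMax
    (Y := fun n ω => f ω n ^ 2) (fun n => (hfm n).pow_const 2) N).mono (G.le N) le_rfl
  have hpt (ω : Ω) : seqVar ρ (f ω) ≤ K * (ENNReal.ofReal (Z₀ ω)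
      + ∑' m, ENNReal.ofReal c ^ m * ENNReal.ofReal (Z m ω)) := by
    refine H (f ω) N _ (fun n hn => ?_) ?_ fun m => ?_
    · simp only [hf]
      rw [← sub_eq_zero, Finset.sum_range_sub_sum_range hn]
      exact Finset.sum_eq_zero fun k hk => hN k (by simp at hk; exact hk.2) ω
    · refine le_add_right (ENNReal.ofReal_le_ofReal (runMax_le fun k hk => ?_))
      rw [← Real.sqrt_sq_eq_abs]
      exact (sqrt_le_davisMax (d := fun k => d k ω) (Y := fun k => f ω k ^ 2) (by simp [hf]) k).trans
        (davisMax_mono _ _ hk)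
    · refine le_add_left (le_trans ?_ (ENNReal.le_tsum m))
      gcongr
      refine le_trans (Real.sqrt_le_sqrt ?_)
        (sqrt_le_davisMax (d := fun k => d k ω) (Y := fun k => Y m k ω)
          (by simp [hY, anchorSq, anchor]) N)
      exact le_add_of_nonneg_right (sq_nonneg _)
  calc _ ≤ ∫⁻ ω, K * (ENNReal.ofReal (Z₀ ω)
        + ∑' m, ENNReal.ofReal c ^ m * ENNReal.ofReal (Z m ω)) ∂μ := lintegral_mono hpt
    _ = K * (∫⁻ ω, ENNReal.ofReal (Z₀ ω) ∂μ
        + ∑' m, ENNReal.ofReal c ^ m * ∫⁻ ω, ENNReal.ofReal (Z m ω) ∂μ) := by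
      rw [lintegral_const_mul' _ _ hK.ne, lintegral_add_left hZ₀m.ennreal_ofReal,
        lintegral_tsum fun m => ((hZm m).ennreal_ofReal.const_mul _).aemeasurable]
      simp_rw [lintegral_const_mul _ (hZm _).ennreal_ofReal]
    _ ≤ K * (24 * ∫⁻ ω, ENNReal.ofReal (sqFun d N ω) ∂μ
        + ∑' m, ENNReal.ofReal c ^ m * (24 * ∫⁻ ω, ENNReal.ofReal (sqFun d N ω) ∂μ)) := by
      gcongr with m
      exact hZ m
    _ = _ := by
      rw [ENNReal.tsum_mul_right, ENNReal.tsum_geometric]; ring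

lemma rpow_le_sum_garsia {p : ℝ} (hp : 1 < p) (x : ℕ → ℝ) (hx : Monotone x) (hx0 : x 0 = 0)
    (N : ℕ) : x N ^ p ≤ p * ∑ n ∈ Finset.range N,
      (x (n + 1) ^ (p - 1) - x n ^ (p - 1)) * (x N - x n) := by
  have hnn (n : ℕ) : 0 ≤ x n := hx0 ▸ hx (Nat.zero_le n)
  have hp0 : 0 < p := by linarith
  have hsplit (n : ℕ) : x n ^ p = x n ^ (p - 1) * x n := by
    conv_rhs => rw [← Real.rpow_one (x n), ← Real.rpow_mul (hnn n)]
    rw [one_mul, ← Real.rpow_add_of_nonneg (hnn n) (by linarith) zero_le_one]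
    congr 1; ring
  have hstep (n : ℕ) : p * ((x (n + 1) ^ (p - 1) - x n ^ (p - 1)) * x n)
      ≤ (p - 1) * (x (n + 1) ^ p - x n ^ p) := by
    have hc : (p / (p - 1)).HolderConjugate p := by
      rw [Real.holderConjugate_iff]
      refine ⟨(one_lt_div (by linarith)).2 (by linarith), ?_⟩
      have : p - 1 ≠ 0 := by linarith
      field_simp; ring
    have hY := Real.young_inequality_of_nonneg (Real.rpow_nonneg (hnn (n + 1)) (p - 1)) (hnn n) hc
    rw [← Real.rpow_mul (hnn _), mul_div_cancel₀ _ (by linarith : p - 1 ≠ 0)] at hY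
    have hY' : p * (x (n + 1) ^ (p - 1) * x n) ≤ (p - 1) * x (n + 1) ^ p + x n ^ p := by
      calc _ ≤ p * (x (n + 1) ^ p / (p / (p - 1)) + x n ^ p / p) := by gcongr
        _ = _ := by field_simp
    have := hsplit n
    nlinarith
  have hsum : p * ∑ n ∈ Finset.range N, (x (n + 1) ^ (p - 1) - x n ^ (p - 1)) * x n
      ≤ (p - 1) * x N ^ p := by
    rw [Finset.mul_sum]
    refine (Finset.sum_le_sum fun n _ => hstep n).trans_eq ?_
    rw [← Finset.mul_sum, Finset.sum_range_sub (fun n => x n ^ p), hx0,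
      Real.zero_rpow hp0.ne', sub_zero]
  have htel : ∑ n ∈ Finset.range N, (x (n + 1) ^ (p - 1) - x n ^ (p - 1)) * (x N - x n)
      = x N ^ p - ∑ n ∈ Finset.range N, (x (n + 1) ^ (p - 1) - x n ^ (p - 1)) * x n := by
    simp_rw [mul_sub, Finset.sum_sub_distrib, ← Finset.sum_mul]
    rw [Finset.sum_range_sub (fun n => x n ^ (p - 1)), hx0,
      Real.zero_rpow (by linarith), sub_zero, ← hsplit]
  rw [htel]; linarith

/-- Setwise domination extends to nonnegative weights. -/
lemma lintegral_mul_le_of_setLIntegral_le {Ω : Type*} {m mΩ : MeasurableSpace Ω} (hm : m ≤ mΩ)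
    {μ : Measure Ω} {Φ Ψ w : Ω → ℝ≥0∞} (hΦ : Measurable Φ) (hΨ : Measurable Ψ)
    (hw : Measurable[m] w)
    (h : ∀ E, MeasurableSet[m] E → ∫⁻ ω in E, Φ ω ∂μ ≤ ∫⁻ ω in E, Ψ ω ∂μ) :
    ∫⁻ ω, w ω * Φ ω ∂μ ≤ ∫⁻ ω, w ω * Ψ ω ∂μ := by
  have hle : (μ.withDensity Φ).trim hm ≤ (μ.withDensity Ψ).trim hm := by
    refine Measure.le_iff.2 fun E hE => ?_
    rw [trim_measurableSet_eq hm hE, trim_measurableSet_eq hm hE,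
      withDensity_apply _ (hm _ hE), withDensity_apply _ (hm _ hE)]
    exact h E hE
  have hconv (Φ : Ω → ℝ≥0∞) (hΦ : Measurable Φ) :
      ∫⁻ ω, w ω * Φ ω ∂μ = ∫⁻ ω, w ω ∂((μ.withDensity Φ).trim hm) := by
    rw [lintegral_trim hm hw, lintegral_withDensity_eq_lintegral_mul _ hΦ (hw.mono hm le_rfl)]
    simp [mul_comm]
  rw [hconv Φ hΦ, hconv Ψ hΨ]
  exact lintegral_mono' hle le_rfl

/-- Garsia's lemma for increasing adapted processes. -/
lemma lintegral_rpow_le_garsia {Ω : Type*} {mΩ : MeasurableSpace Ω} {μ : Measure Ω}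
    {G : Filtration ℕ mΩ} {p : ℝ} (hp : 1 < p) {x : ℕ → Ω → ℝ} {Φ : ℕ → Ω → ℝ≥0∞}
    {Z : Ω → ℝ≥0∞} {C : ℝ≥0∞} {N : ℕ} (hxm : ∀ n, Measurable[G n] (x n))
    (hx : ∀ ω, Monotone fun n => x n ω) (hx0 : ∀ ω, x 0 ω = 0) (hΦ : ∀ n, Measurable (Φ n))
    (hZ : Measurable Z) (hxΦ : ∀ n < N, ∀ ω, ENNReal.ofReal (x N ω - x n ω) ≤ Φ n ω)
    (h : ∀ n < N, ∀ E, MeasurableSet[G (n + 1)] E →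
      ∫⁻ ω in E, Φ n ω ∂μ ≤ ∫⁻ ω in E, C * Z ω ∂μ)
    (hfin : ∫⁻ ω, ENNReal.ofReal (x N ω) ^ p ∂μ ≠ ∞) :
    (∫⁻ ω, ENNReal.ofReal (x N ω) ^ p ∂μ) ^ (1 / p)
      ≤ ENNReal.ofReal p * C * (∫⁻ ω, Z ω ^ p ∂μ) ^ (1 / p) := by
  have hp0 : 0 < p := by linarith
  have hnn (n : ℕ) (ω : Ω) : 0 ≤ x n ω := hx0 ω ▸ hx ω (Nat.zero_le n)
  set w : ℕ → Ω → ℝ≥0∞ := fun n ω =>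
    ENNReal.ofReal (x (n + 1) ω ^ (p - 1) - x n ω ^ (p - 1)) with hw
  have hwnn (n : ℕ) (ω : Ω) : 0 ≤ x (n + 1) ω ^ (p - 1) - x n ω ^ (p - 1) :=
    sub_nonneg.2 (Real.rpow_le_rpow (hnn n ω) (hx ω n.le_succ) (by linarith))
  have hwm (n : ℕ) : Measurable[G (n + 1)] (w n) :=
    (((hxm (n + 1)).pow_const (p - 1)).sub
      (((hxm n).mono (G.mono n.le_succ) le_rfl).pow_const (p - 1))).ennreal_ofReal
  have hwsum (ω : Ω) : ∑ n ∈ Finset.range N, w n ω = ENNReal.ofReal (x N ω) ^ (p - 1) := by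
    rw [← ENNReal.ofReal_sum_of_nonneg fun n _ => hwnn n ω,
      Finset.sum_range_sub (fun n => x n ω ^ (p - 1)), hx0, Real.zero_rpow (by linarith),
      sub_zero, ENNReal.ofReal_rpow_of_nonneg (hnn N ω) (by linarith)]
  have hpt (ω : Ω) : ENNReal.ofReal (x N ω) ^ p
      ≤ ENNReal.ofReal p * ∑ n ∈ Finset.range N, w n ω * Φ n ω := by
    rw [ENNReal.ofReal_rpow_of_nonneg (hnn N ω) hp0.le]
    refine (ENNReal.ofReal_le_ofReal
      (rpow_le_sum_garsia hp (fun n => x n ω) (hx ω) (hx0 ω) N)).trans ?_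
    rw [ENNReal.ofReal_mul hp0.le, ENNReal.ofReal_sum_of_nonneg fun n hn => mul_nonneg (hwnn n ω)
      (sub_nonneg.2 (hx ω (Finset.mem_range.1 hn).le))]
    refine mul_le_mul' le_rfl (Finset.sum_le_sum fun n hn => ?_)
    rw [ENNReal.ofReal_mul (hwnn n ω)]
    exact mul_le_mul' le_rfl (hxΦ n (Finset.mem_range.1 hn) ω)
  have hxN : Measurable fun ω => ENNReal.ofReal (x N ω) :=
    ((hxm N).mono (G.le N) le_rfl).ennreal_ofReal
  set I := ∫⁻ ω, ENNReal.ofReal (x N ω) ^ p ∂μ with hI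
  have hc : (p / (p - 1)).HolderConjugate p := by
    rw [Real.holderConjugate_iff]
    refine ⟨(one_lt_div (by linarith)).2 (by linarith), ?_⟩
    have : p - 1 ≠ 0 := by linarith
    field_simp; ring
  have hmain : I ≤ I ^ ((p - 1) / p) *
      (ENNReal.ofReal p * C * (∫⁻ ω, Z ω ^ p ∂μ) ^ (1 / p)) := by
    calc I ≤ ∫⁻ ω, ENNReal.ofReal p * ∑ n ∈ Finset.range N, w n ω * Φ n ω ∂μ :=
          lintegral_mono hpt
      _ = ENNReal.ofReal p * ∑ n ∈ Finset.range N, ∫⁻ ω, w n ω * Φ n ω ∂μ := by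
          rw [lintegral_const_mul' _ _ ENNReal.ofReal_ne_top, lintegral_finsetSum]
          exact fun n _ => ((hwm n).mono (G.le _) le_rfl).mul (hΦ n)
      _ ≤ ENNReal.ofReal p * ∑ n ∈ Finset.range N, ∫⁻ ω, w n ω * (C * Z ω) ∂μ := by
          refine mul_le_mul' le_rfl (Finset.sum_le_sum fun n hn => ?_)
          exact lintegral_mul_le_of_setLIntegral_le (G.le (n + 1)) (hΦ n) (hZ.const_mul C)
            (hwm n) (h n (Finset.mem_range.1 hn))
      _ = ENNReal.ofReal p * (C * ∫⁻ ω, ENNReal.ofReal (x N ω) ^ (p - 1) * Z ω ∂μ) := by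
          have hm (n : ℕ) : Measurable fun ω => w n ω * (C * Z ω) :=
            ((hwm n).mono (G.le _) le_rfl).mul (hZ.const_mul C)
          rw [← lintegral_finsetSum _ fun n _ => hm n,
            ← lintegral_const_mul (f := fun ω => ENNReal.ofReal (x N ω) ^ (p - 1) * Z ω) _
              ((hxN.pow_const _).mul hZ)]
          congr 1
          refine lintegral_congr fun ω => ?_
          rw [← Finset.sum_mul, hwsum]; ring
      _ ≤ ENNReal.ofReal p * (C * (I ^ (1 / (p / (p - 1))) * (∫⁻ ω, Z ω ^ p ∂μ) ^ (1 / p))) := by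
          gcongr
          refine (ENNReal.lintegral_mul_le_Lp_mul_Lq μ hc (hxN.pow_const _).aemeasurable
            hZ.aemeasurable).trans_eq ?_
          simp_rw [← ENNReal.rpow_mul, mul_div_cancel₀ p (by linarith : p - 1 ≠ 0)]
          rfl
      _ = _ := by rw [one_div_div]; ring
  rcases eq_or_ne I 0 with h0 | h0
  · rw [h0, ENNReal.zero_rpow_of_pos (by positivity)]; exact zero_le
  have hsplit : I = I ^ ((p - 1) / p) * I ^ (1 / p) := by
    rw [← ENNReal.rpow_add _ _ h0 hfin]
    conv_lhs => rw [← ENNReal.rpow_one I]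
    congr 1; field_simp; ring
  have hne0 : I ^ ((p - 1) / p) ≠ 0 := by
    simp [h0, hfin]
  have hnet : I ^ ((p - 1) / p) ≠ ∞ :=
    ENNReal.rpow_ne_top_of_nonneg (div_nonneg (by linarith) hp0.le) hfin
  exact (ENNReal.mul_le_mul_iff_right hne0 hnet).1 (hsplit.symm.trans_le hmain)

lemma sum_range_truncate (d : ℕ → ℝ) (n k : ℕ) :
    ∑ i ∈ Finset.range k, (if i < n then d i else 0) = ∑ i ∈ Finset.range (min k n), d i := by
  rw [← Finset.sum_filter]
  congr 1
  ext i
  simp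

lemma seqVar_truncate_mono (ρ : ℝ) (d : ℕ → ℝ) :
    Monotone fun n => seqVar ρ fun k => ∑ i ∈ Finset.range k, if i < n then d i else 0 := by
  intro n m hnm
  simp_rw [sum_range_truncate]
  refine le_trans (le_of_eq ?_) (seqVar_comp_le ρ (fun k => ∑ i ∈ Finset.range (min k m), d i)
    (φ := fun k => min k n) fun a b hab => min_le_min_right n hab)
  simp_rw [min_assoc, min_eq_left hnm]

lemma seqVar_le_truncate_add {ρ : ℝ} (hρ : 1 ≤ ρ) (d : ℕ → ℝ) {n N : ℕ} (hn : n < N) :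
    seqVar ρ (fun k => ∑ i ∈ Finset.range k, d i)
      ≤ seqVar ρ (fun k => ∑ i ∈ Finset.range k, if i < n then d i else 0)
        + (ENNReal.ofReal |d n|
          + seqVar ρ (fun k => ∑ i ∈ Finset.range k, if n + 1 ≤ i then d i else 0)) := by
  have h1 : seqVar ρ (fun k => ∑ i ∈ Finset.range k, if i = n then d i else 0)
      ≤ ENNReal.ofReal |d n| := by
    refine (seqVar_sum_range_le hρ _ (N := N) fun k hk => if_neg (by omega)).trans ?_
    rw [Finset.sum_eq_single n]
    · simp
    · intro b _ hb; simp [hb]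
    · intro h; simp [hn] at h
  refine le_trans (le_of_eq ?_) ((seqVar_add_le hρ _ _).trans (add_le_add_right
    ((seqVar_add_le hρ _ _).trans (add_le_add_left h1 _)) _))
  simp_rw [← Finset.sum_add_distrib]
  congr 1
  funext k
  refine Finset.sum_congr rfl fun i _ => ?_
  rcases lt_trichotomy i n with h | h | h
  · simp [h, h.ne]; omega
  · simp [h]
  · simp [h.not_gt, h.ne', Nat.succ_le_of_lt h]

/-- The `Lᵖ` variational Burkholder–Davis–Gundy inequality. -/
lemma exists_lintegral_seqVar_rpow_le {ρ p : ℝ} (hρ : 2 < ρ) (hp : 1 ≤ p) :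
    ∃ C : ℝ≥0∞, C < ∞ ∧ ∀ (Ω : Type) (mΩ : MeasurableSpace Ω) (μ : Measure Ω)
      (G : Filtration ℕ mΩ) (d : ℕ → Ω → ℝ) (N : ℕ), IsMartingaleDiff μ G d →
      (∀ k, N ≤ k → ∀ ω, d k ω = 0) →
      (∫⁻ ω, seqVar ρ (fun n => ∑ k ∈ Finset.range n, d k ω) ^ p ∂μ) ^ (1 / p)
        ≤ C * (∫⁻ ω, ENNReal.ofReal (sqFun d N ω) ^ p ∂μ) ^ (1 / p) := by
  obtain ⟨C, hC, H⟩ := exists_lintegral_seqVar_le hρ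
  rcases hp.eq_or_lt with rfl | hp
  · exact ⟨C, hC, by simpa using H⟩
  have hρ1 : 1 ≤ ρ := by linarith
  have hp0 : 0 < p := by linarith
  refine ⟨ENNReal.ofReal p * (1 + C),
    ENNReal.mul_lt_top ENNReal.ofReal_lt_top (ENNReal.add_lt_top.2 ⟨ENNReal.one_lt_top, hC⟩),
    fun Ω mΩ μ G d N hd hN => ?_⟩
  have hZm : Measurable fun ω => ENNReal.ofReal (sqFun d N ω) :=
    ((hd.measurable_sqFun N).mono (G.le N) le_rfl).ennreal_ofReal
  rcases eq_or_ne (∫⁻ ω, ENNReal.ofReal (sqFun d N ω) ^ p ∂μ) ∞ with htop | htop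
  · rw [htop, ENNReal.top_rpow_of_pos (by positivity), ENNReal.mul_top]
    · exact le_top
    · simp [hp0]
  have hbound (ω : Ω) (n : ℕ) :
      seqVar ρ (fun k => ∑ i ∈ Finset.range k, if i < n then d i ω else 0)
        ≤ N * ENNReal.ofReal (sqFun d N ω) := by
    refine (seqVar_sum_range_le hρ1 _ (N := N) fun k hk => by simp [hN k hk ω]).trans ?_
    calc _ ≤ ∑ i ∈ Finset.range N, ENNReal.ofReal (sqFun d N ω) := by
          refine Finset.sum_le_sum fun i hi => ENNReal.ofReal_le_ofReal ?_
          split_ifs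
          · exact abs_le_sqFun (Finset.mem_range.1 hi) ω
          · simpa using sqFun_nonneg d N ω
      _ = _ := by simp
  have hfin (ω : Ω) (n : ℕ) :
      seqVar ρ (fun k => ∑ i ∈ Finset.range k, if i < n then d i ω else 0) ≠ ∞ :=
    ((hbound ω n).trans_lt (ENNReal.mul_lt_top (by simp) ENNReal.ofReal_lt_top)).ne
  have hfull (ω : Ω) : (fun k => ∑ i ∈ Finset.range k, if i < N then d i ω else 0)
      = fun k => ∑ i ∈ Finset.range k, d i ω := by
    funext k
    refine Finset.sum_congr rfl fun i _ => ?_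
    split_ifs with h
    · rfl
    · exact (hN i (not_lt.1 h) ω).symm
  set x : ℕ → Ω → ℝ := fun n ω =>
    (seqVar ρ fun k => ∑ i ∈ Finset.range k, if i < n then d i ω else 0).toReal with hx
  have hxofReal (n : ℕ) (ω : Ω) : ENNReal.ofReal (x n ω)
      = seqVar ρ fun k => ∑ i ∈ Finset.range k, if i < n then d i ω else 0 :=
    ENNReal.ofReal_toReal (hfin ω n)
  have htail (n : ℕ) (E : Set Ω) (hE : MeasurableSet[G (n + 1)] E) :
      ∫⁻ ω in E, seqVar ρ (fun k => ∑ i ∈ Finset.range k, if n + 1 ≤ i then d i ω else 0) ∂μ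
        ≤ C * ∫⁻ ω in E, ENNReal.ofReal (sqFun d N ω) ∂μ := by
    classical
    have hb (k : ℕ) : Measurable[G k] fun ω => if n + 1 ≤ k then E.indicator 1 ω else (0 : ℝ) := by
      split_ifs with h
      · exact (show Measurable[G k] (1 : Ω → ℝ) from measurable_const).indicator (G.mono h _ hE)
      · exact measurable_const
    have hd' := hd.mul hb fun k ω => by
      by_cases h : n + 1 ≤ k <;> by_cases hω : ω ∈ E <;> simp [h, hω]
    have := H Ω mΩ μ G _ N hd' fun k hk ω => by simp [hN k hk ω]
    rw [← lintegral_indicator (G.le _ _ hE), ← lintegral_indicator (G.le _ _ hE)]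
    refine le_trans (lintegral_mono fun ω => ?_) (this.trans
      (mul_le_mul' le_rfl (lintegral_mono fun ω => ?_)))
    · by_cases hω : ω ∈ E <;> simp [hω]
    · by_cases hω : ω ∈ E
      · simp only [hω, indicator_of_mem]
        refine ENNReal.ofReal_le_ofReal (Real.sqrt_le_sqrt (Finset.sum_le_sum fun k _ => ?_))
        dsimp only
        split_ifs <;> simp [hω, sq_nonneg]
      · simp [hω, sqFun]
  have hTm (n : ℕ) : Measurable fun ω =>
      seqVar ρ (fun k => ∑ i ∈ Finset.range k, if n + 1 ≤ i then d i ω else 0) := by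
    refine measurable_seqVar ρ fun k => Finset.measurable_fun_sum _ fun i _ => ?_
    split_ifs
    · exact (hd.meas i).mono (G.le _) le_rfl
    · exact measurable_const
  have hG := lintegral_rpow_le_garsia (μ := μ) (G := G) hp (x := x)
    (Φ := fun n ω => ENNReal.ofReal |d n ω|
      + seqVar ρ (fun k => ∑ i ∈ Finset.range k, if n + 1 ≤ i then d i ω else 0))
    (Z := fun ω => ENNReal.ofReal (sqFun d N ω)) (C := 1 + C) (N := N) ?_ ?_ ?_ ?_ hZm ?_ ?_ ?_
  · simp_rw [hxofReal, hfull] at hG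
    exact hG
  · intro n
    refine (measurable_seqVar ρ fun k => Finset.measurable_fun_sum _ fun i _ => ?_).ennreal_toReal
    split_ifs with h
    · exact (hd.meas i).mono (G.mono h) le_rfl
    · exact measurable_const
  · exact fun ω n m hnm => ENNReal.toReal_mono (hfin ω m)
      (seqVar_truncate_mono ρ (fun i => d i ω) hnm)
  · intro ω
    simp [hx, seqVar_zero (by linarith : 0 < ρ)]
  · exact fun n => (((hd.meas n).mono (G.le _) le_rfl).abs.ennreal_ofReal).add (hTm n)
  · intro n hn ω
    rw [ENNReal.ofReal_sub _ ENNReal.toReal_nonneg, hxofReal, hxofReal, hfull, tsub_le_iff_left]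
    exact seqVar_le_truncate_add hρ1 (fun i => d i ω) hn
  · intro n hn E hE
    rw [lintegral_const_mul _ hZm, lintegral_add_right _ (hTm n), add_mul, one_mul]
    refine add_le_add (lintegral_mono fun ω => ENNReal.ofReal_le_ofReal (abs_le_sqFun hn ω))
      (htail n E hE)
  · refine ne_top_of_le_ne_top ?_ (lintegral_mono fun ω => ENNReal.rpow_le_rpow
      ((hxofReal N ω).trans_le (hbound ω N)) hp0.le)
    simp_rw [ENNReal.mul_rpow_of_nonneg _ _ hp0.le]
    rw [lintegral_const_mul' _ _ (by simp [hp0.le])]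
    exact ENNReal.mul_ne_top (by simp [hp0.le]) htop

lemma lintegral_const_mul_rpow_rpow {Ω : Type*} {mΩ : MeasurableSpace Ω} (μ : Measure Ω) {q : ℝ}
    (hq : 0 < q) {c : ℝ≥0∞} (hc : c ≠ ∞) (f : Ω → ℝ≥0∞) :
    (∫⁻ ω, (c * f ω) ^ q ∂μ) ^ (1 / q) = c * (∫⁻ ω, f ω ^ q ∂μ) ^ (1 / q) := by
  simp_rw [ENNReal.mul_rpow_of_nonneg _ _ hq.le]
  rw [lintegral_const_mul' _ _ (by simp [hc, hq.le]), ENNReal.mul_rpow_of_nonneg _ _ (by positivity),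
    ← ENNReal.rpow_mul, mul_one_div_cancel hq.ne', ENNReal.rpow_one]

lemma lintegral_sum_rpow_rpow_le {Ω ι : Type*} {mΩ : MeasurableSpace Ω} (μ : Measure Ω) {q : ℝ}
    (hq : 1 ≤ q) (s : Finset ι) {f : ι → Ω → ℝ≥0∞} (hf : ∀ i, Measurable (f i)) :
    (∫⁻ ω, (∑ i ∈ s, f i ω) ^ q ∂μ) ^ (1 / q) ≤ ∑ i ∈ s, (∫⁻ ω, f i ω ^ q ∂μ) ^ (1 / q) := by
  classical
  have hq0 : 0 < q := by linarith
  induction s using Finset.induction_on with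
  | empty => simp [hq0, ENNReal.zero_rpow_of_pos]
  | insert i s hi ih =>
    simp_rw [Finset.sum_insert hi]
    exact (ENNReal.lintegral_Lp_add_le (hf i).aemeasurable
      (Finset.measurable_fun_sum s fun j _ => hf j).aemeasurable hq).trans (add_le_add_right ih _)

/-- Variational bound for predictable transforms whose deterministic weights are supported in `A`
and bounded by `s`; the predictable increasing factor `M` is pulled out pathwise. -/
lemma exists_weighted_seqVar_le {ρ q₀ : ℝ} (hρ : 2 < ρ) (hq₀ : 1 ≤ q₀) :
    ∃ C : ℝ≥0∞, C < ∞ ∧ ∀ (r : ℝ), 1 ≤ r → r ≤ ρ →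
      ∀ (Ω : Type) (mΩ : MeasurableSpace Ω) (μ : Measure Ω)
      (G : Filtration ℕ mΩ) (d b : ℕ → Ω → ℝ) (N : ℕ), IsMartingaleDiff μ G d →
      (∀ k, N ≤ k → ∀ ω, d k ω = 0) → (∀ k, Measurable[G k] (b k)) → (∀ k ω, |b k ω| ≤ 1) →
      ∀ (Δ : ℕ → ℝ) (A : Finset ℕ) (s : ℝ), 0 ≤ s → (∀ k ∈ A, |Δ k| ≤ s) →
      ∃ H : Ω → ℝ≥0∞, Measurable H ∧
        (∫⁻ ω, H ω ^ q₀ ∂μ) ^ (1 / q₀) ≤ C * ((A.card : ℝ≥0∞) ^ (1 / r - 1 / ρ) * ENNReal.ofReal s)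
          * (∫⁻ ω, ENNReal.ofReal (sqFun d N ω) ^ q₀ ∂μ) ^ (1 / q₀) ∧
        ∀ (ω : Ω) (M : ℕ → ℝ), Monotone M → 0 ≤ M 0 →
          seqVar r (fun n => ∑ k ∈ Finset.range n,
            if k ∈ A then M k * (b k ω * Δ k * d k ω) else 0) ≤ ENNReal.ofReal (M N) * H ω := by
  obtain ⟨C, hC, hH⟩ := exists_lintegral_seqVar_rpow_le hρ hq₀
  refine ⟨C, hC, fun r hr hrρ Ω mΩ μ G d b N hd hN hb hb1 Δ A s hs hΔ => ?_⟩
  have hq0 : 0 < q₀ := by linarith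
  have hr0 : 0 < r := by linarith
  set b' : ℕ → Ω → ℝ := fun k ω => if k ∈ A then b k ω * (Δ k / s) else 0 with hb'
  have hb'1 (k : ℕ) (ω : Ω) : |b' k ω| ≤ 1 := by
    simp only [hb']
    split_ifs with h
    · rw [abs_mul, abs_div, abs_of_nonneg hs]
      exact mul_le_one₀ (hb1 k ω) (by positivity) (div_le_one_of_le₀ (hΔ k h) hs)
    · simp
  have hd' := hd.mul (b := b') (fun k => by
    simp only [hb']
    split_ifs
    · exact (hb k).mul_const _
    · exact measurable_const) hb'1
  have hN' (k : ℕ) (hk : N ≤ k) (ω : Ω) : b' k ω * d k ω = 0 := by rw [hN k hk, mul_zero]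
  have hθ : (0 : ℝ) ≤ 1 / r - 1 / ρ := sub_nonneg.2 (one_div_le_one_div_of_le hr0 hrρ)
  have hcs : (A.card : ℝ≥0∞) ^ (1 / r - 1 / ρ) * ENNReal.ofReal s ≠ ∞ :=
    ENNReal.mul_ne_top (ENNReal.rpow_ne_top_of_nonneg hθ (by simp)) ENNReal.ofReal_ne_top
  refine ⟨fun ω => (A.card : ℝ≥0∞) ^ (1 / r - 1 / ρ) * ENNReal.ofReal s
      * seqVar ρ fun n => ∑ k ∈ Finset.range n, b' k ω * d k ω, ?_, ?_, fun ω M hM hM0 => ?_⟩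
  · exact (measurable_seqVar ρ fun n => (hd'.measurable_sum n).mono (G.le n) le_rfl).const_mul _
  · rw [lintegral_const_mul_rpow_rpow μ hq0 hcs, mul_comm C, mul_assoc (_ * _) C]
    refine mul_le_mul' le_rfl ((hH Ω mΩ μ G _ N hd' hN').trans (mul_le_mul' le_rfl ?_))
    refine ENNReal.rpow_le_rpow (lintegral_mono fun ω => ENNReal.rpow_le_rpow
      (ENNReal.ofReal_le_ofReal (Real.sqrt_le_sqrt (Finset.sum_le_sum fun k _ => ?_))) hq0.le)
      (by positivity)
    rw [mul_pow, ← sq_abs (b' k ω)]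
    exact mul_le_of_le_one_left (sq_nonneg _) (pow_le_one₀ (abs_nonneg _) (hb'1 k ω))
  · have heq (k : ℕ) : (if k ∈ A then M k * (b k ω * Δ k * d k ω) else 0)
        = s * (M k * (b' k ω * d k ω)) := by
      simp only [hb']
      split_ifs with h
      · rcases hs.eq_or_lt with rfl | hs
        · rw [abs_nonpos_iff.1 (hΔ k h)]; simp
        · field_simp
      · simp
    simp_rw [heq, ← Finset.mul_sum]
    rw [seqVar_const_mul hr0, abs_of_nonneg hs]
    calc _ ≤ ENNReal.ofReal s * (ENNReal.ofReal (M N)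
          * ((A.card : ℝ≥0∞) ^ (1 / r - 1 / ρ)
            * seqVar ρ fun n => ∑ k ∈ Finset.range n, b' k ω * d k ω)) := by
          refine mul_le_mul' le_rfl ((seqVar_mul_monotone_le hr M _ hM hM0 (fun k hk => hN' k hk ω)).trans
            (mul_le_mul' le_rfl (seqVar_le_card_mul hr0 hrρ _ A fun k hk => ?_)))
          simp [hb', hk]
      _ = _ := by ring

/-- The `ℓᵖ` norm of `Δ 0, …, Δ (N - 1)`. -/
noncomputable def finNorm (p₁ : ℝ≥0∞) (Δ : ℕ → ℝ) (N : ℕ) : ℝ≥0∞ :=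
  if p₁ = ∞ then ⨆ (k : ℕ) (_ : k < N), ENNReal.ofReal |Δ k|
  else (∑ k ∈ Finset.range N, ENNReal.ofReal |Δ k| ^ p₁.toReal) ^ (1 / p₁.toReal)

lemma ofReal_abs_le_finNorm {p₁ : ℝ≥0∞} (hp₁ : 2 ≤ p₁) (Δ : ℕ → ℝ) {N k : ℕ} (hk : k < N) :
    ENNReal.ofReal |Δ k| ≤ finNorm p₁ Δ N := by
  rw [finNorm]
  split_ifs with h
  · exact le_iSup₂ (f := fun k (_ : k < N) => ENNReal.ofReal |Δ k|) k hk
  · have hp : 0 < p₁.toReal := ENNReal.toReal_pos (by positivity) h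
    rw [one_div, ENNReal.le_rpow_inv_iff hp]
    exact Finset.single_le_sum (f := fun k => ENNReal.ofReal |Δ k| ^ p₁.toReal)
      (fun _ _ => zero_le) (Finset.mem_range.2 hk)

lemma finNorm_ne_top {p₁ : ℝ≥0∞} (Δ : ℕ → ℝ) (N : ℕ) : finNorm p₁ Δ N ≠ ∞ := by
  rw [finNorm]
  split_ifs with h
  · refine ne_top_of_le_ne_top (b := ∑ k ∈ Finset.range N, ENNReal.ofReal |Δ k|) (by simp)
      (iSup₂_le fun k hk => ?_)
    exact Finset.single_le_sum (f := fun k => ENNReal.ofReal |Δ k|)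
      (fun _ _ => zero_le) (Finset.mem_range.2 hk)
  · refine ENNReal.rpow_ne_top_of_nonneg (by positivity) ?_
    simp

lemma card_level_rpow_mul_le {p θ D : ℝ} (hp : 0 < p) (hθ : 0 ≤ θ) (hD : 0 < D) (Δ : ℕ → ℝ)
    (A : Finset ℕ) (m : ℕ) (h : ∀ k ∈ A, (1 / 2) ^ (m + 1) * D ≤ |Δ k|)
    (hs : ∑ k ∈ A, |Δ k| ^ p ≤ D ^ p) :
    (A.card : ℝ) ^ θ * ((1 / 2) ^ m * D) ≤ 2 ^ (p * θ) * (2 ^ (p * θ - 1)) ^ m * D := by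
  have hcard : (A.card : ℝ) ≤ (2 ^ (m + 1)) ^ p := by
    have h1 : (A.card : ℝ) * ((1 / 2) ^ (m + 1) * D) ^ p ≤ D ^ p := by
      refine le_trans ?_ hs
      rw [← nsmul_eq_mul]
      exact Finset.card_nsmul_le_sum _ _ _ fun k hk =>
        Real.rpow_le_rpow (by positivity) (h k hk) hp.le
    rw [Real.mul_rpow (by positivity) hD.le, ← mul_assoc] at h1
    have h2 := le_of_mul_le_mul_right (h1.trans_eq (one_mul _).symm) (Real.rpow_pos_of_pos hD p)
    have h3 : ((1 / 2 : ℝ) ^ (m + 1)) ^ p * (2 ^ (m + 1)) ^ p = 1 := by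
      rw [← Real.mul_rpow (by positivity) (by positivity), ← mul_pow]; norm_num
    calc (A.card : ℝ) = A.card * ((1 / 2 : ℝ) ^ (m + 1)) ^ p * (2 ^ (m + 1)) ^ p := by
          rw [mul_assoc, h3, mul_one]
      _ ≤ 1 * (2 ^ (m + 1)) ^ p := by gcongr
      _ = _ := one_mul _
  have h4 : (A.card : ℝ) ^ θ ≤ 2 ^ (p * θ) * (2 ^ (p * θ)) ^ m := by
    calc (A.card : ℝ) ^ θ ≤ ((2 ^ (m + 1)) ^ p) ^ θ := by gcongr
      _ = 2 ^ (p * θ) * (2 ^ (p * θ)) ^ m := by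
        rw [← Real.rpow_mul (by positivity), ← pow_succ', ← Real.rpow_natCast, ← Real.rpow_natCast,
          ← Real.rpow_mul (by norm_num), ← Real.rpow_mul (by norm_num), mul_comm]
  calc (A.card : ℝ) ^ θ * ((1 / 2) ^ m * D)
      ≤ 2 ^ (p * θ) * (2 ^ (p * θ)) ^ m * ((1 / 2) ^ m * D) := by gcongr
    _ = _ := by
      rw [Real.rpow_sub_one (by norm_num), div_pow, div_pow, one_pow]
      ring

lemma exists_interpolation_exponent {r p : ℝ} (hr : 0 < r) (hp : 0 < p)
    (hrp : 1 / r < 1 / 2 + 1 / p) :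
    ∃ ρ : ℝ, 2 < ρ ∧ r ≤ ρ ∧ p * (1 / r - 1 / ρ) < 1 := by
  by_cases h2 : 2 < r
  · exact ⟨r, h2, le_rfl, by simp⟩
  have hr2 : 1 / 2 ≤ 1 / r := one_div_le_one_div_of_le hr (not_lt.1 h2)
  set t := (max (1 / r - 1 / p) 0 + 1 / 2) / 2 with ht
  have h0 : 0 ≤ max (1 / r - 1 / p) 0 := le_max_right _ _
  have h1 : max (1 / r - 1 / p) 0 < 1 / 2 := max_lt (by linarith) (by norm_num)
  have h3 : 1 / r - 1 / p ≤ max (1 / r - 1 / p) 0 := le_max_left _ _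
  have ht0 : 0 < t := by rw [ht]; linarith
  refine ⟨1 / t, ?_, ?_, ?_⟩
  · rw [lt_div_iff₀ ht0]; linarith
  · rw [le_div_iff₀ ht0]
    have : r * t ≤ r * (1 / r) := by gcongr; linarith
    rwa [mul_one_div_cancel hr.ne'] at this
  · rw [one_div_one_div]
    have : p * (1 / r - t) < p * (1 / p) := by gcongr; linarith
    rwa [mul_one_div_cancel hp.ne'] at this

lemma exists_transform_seqVar_le {q₀ r : ℝ} {p₁ : ℝ≥0∞} (hq₀ : 1 ≤ q₀) (hp₁ : 2 ≤ p₁) (hr : 0 < r)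
    (hrp : ENNReal.ofReal (1 / r) < 1 / 2 + 1 / p₁) :
    ∃ C : ℝ≥0∞, C < ∞ ∧
      ∀ (Ω : Type) (mΩ : MeasurableSpace Ω) (μ : Measure Ω)
      (G : Filtration ℕ mΩ) (d b : ℕ → Ω → ℝ) (N : ℕ), IsMartingaleDiff μ G d →
      (∀ k, N ≤ k → ∀ ω, d k ω = 0) → (∀ k, Measurable[G k] (b k)) → (∀ k ω, |b k ω| ≤ 1) →
      ∀ (Δ : ℕ → ℝ),
      ∃ H : Ω → ℝ≥0∞, Measurable H ∧
        (∫⁻ ω, H ω ^ q₀ ∂μ) ^ (1 / q₀) ≤ C * finNorm p₁ Δ N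
          * (∫⁻ ω, ENNReal.ofReal (sqFun d N ω) ^ q₀ ∂μ) ^ (1 / q₀) ∧
        ∀ (ω : Ω) (M : ℕ → ℝ), Monotone M → 0 ≤ M 0 →
          seqVar r (fun n => ∑ k ∈ Finset.range n, M k * (b k ω * Δ k * d k ω))
            ≤ ENNReal.ofReal (M N) * H ω := by
  have hp0 : p₁ ≠ 0 := (lt_of_lt_of_le (by norm_num) hp₁).ne'
  have hΔle (Δ : ℕ → ℝ) {N k : ℕ} (hk : k < N) : |Δ k| ≤ (finNorm p₁ Δ N).toReal := by
    rw [← ENNReal.ofReal_le_iff_le_toReal (finNorm_ne_top Δ N)]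
    exact ofReal_abs_le_finNorm hp₁ Δ hk
  rcases eq_or_ne p₁ ∞ with hpt | hpt
  · have hr2 : 2 < r := by
      rw [hpt, ENNReal.div_top, add_zero, ← ENNReal.ofReal_ofNat, ← ENNReal.ofReal_one,
        ← ENNReal.ofReal_div_of_pos (by norm_num), ENNReal.ofReal_lt_ofReal_iff (by norm_num)] at hrp
      exact (one_div_lt_one_div hr (by norm_num)).1 hrp
    obtain ⟨C, hC, h⟩ := exists_weighted_seqVar_le hr2 hq₀
    refine ⟨C, hC, fun Ω mΩ μ G d b N hd hN hb hb1 Δ => ?_⟩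
    obtain ⟨H, hHm, hH, hHb⟩ := h r (by linarith) le_rfl Ω mΩ μ G d b N hd hN hb hb1 Δ
      (Finset.range N) (finNorm p₁ Δ N).toReal ENNReal.toReal_nonneg
      fun k hk => hΔle Δ (Finset.mem_range.1 hk)
    refine ⟨H, hHm, ?_, fun ω M hM hM0 => ?_⟩
    · simpa [ENNReal.ofReal_toReal (finNorm_ne_top Δ N)] using hH
    · convert hHb ω M hM hM0 using 5 with n k hk
      split_ifs with hkN
      · rfl
      · rw [hN k (by simpa using hkN)]; simp
  set p := p₁.toReal with hp
  have hp2 : 0 < p := ENNReal.toReal_pos hp0 hpt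
  have hrp' : 1 / r < 1 / 2 + 1 / p := by
    have h1 : (1 / 2 + 1 / p₁ : ℝ≥0∞) = ENNReal.ofReal (1 / 2 + 1 / p) := by
      rw [ENNReal.ofReal_add (by norm_num) (by positivity), ENNReal.ofReal_div_of_pos (by norm_num),
        ENNReal.ofReal_div_of_pos hp2, hp, ENNReal.ofReal_toReal hpt]
      simp
    rw [h1, ENNReal.ofReal_lt_ofReal_iff (by positivity)] at hrp
    exact hrp
  have hp2' : 2 ≤ p := by
    have := ENNReal.toReal_mono hpt hp₁
    simpa using this
  have hr1 : 1 ≤ r := by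
    have h1 : 1 / p ≤ 1 / 2 := one_div_le_one_div_of_le (by norm_num) hp2'
    have h2 : 1 / r < 1 := by linarith
    rw [div_lt_one hr] at h2
    exact h2.le
  obtain ⟨ρ, hρ2, hρr, hρp⟩ := exists_interpolation_exponent hr hp2 hrp'
  have hθ : (0 : ℝ) ≤ 1 / r - 1 / ρ := sub_nonneg.2 (one_div_le_one_div_of_le hr hρr)
  obtain ⟨C, hC, h⟩ := exists_weighted_seqVar_le hρ2 hq₀
  set θ := 1 / r - 1 / ρ
  set K₀ := ENNReal.ofReal (2 ^ (p * θ))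
  set c := ENNReal.ofReal (2 ^ (p * θ - 1)) with hc
  have hc1 : c < 1 := by
    rw [hc, ← ENNReal.ofReal_one, ENNReal.ofReal_lt_ofReal_iff (by norm_num)]
    exact Real.rpow_lt_one_of_one_lt_of_neg (by norm_num) (by linarith)
  refine ⟨C * (K₀ * (1 - c)⁻¹), ?_, fun Ω mΩ μ G d b N hd hN hb hb1 Δ => ?_⟩
  · refine ENNReal.mul_lt_top hC (ENNReal.mul_lt_top ENNReal.ofReal_lt_top ?_)
    rw [lt_top_iff_ne_top, ENNReal.inv_ne_top]
    exact (tsub_pos_of_lt hc1).ne'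
  set D := (finNorm p₁ Δ N).toReal with hD
  have hD0 : 0 ≤ D := ENNReal.toReal_nonneg
  have hDof : ENNReal.ofReal D = finNorm p₁ Δ N := ENNReal.ofReal_toReal (finNorm_ne_top Δ N)
  have hlevel (k : ℕ) : ∃ m, k < N → Δ k ≠ 0 →
      (1 / 2) ^ (m + 1) * D ≤ |Δ k| ∧ |Δ k| ≤ (1 / 2) ^ m * D := by
    by_cases hk : k < N ∧ Δ k ≠ 0
    · have hpos : 0 < |Δ k| := abs_pos.2 hk.2
      have hDpos : 0 < D := hpos.trans_le (hΔle Δ hk.1)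
      obtain ⟨m, h1, h2⟩ := exists_nat_pow_near_of_lt_one (x := |Δ k| / D) (y := 1 / 2)
        (by positivity) ((div_le_one hDpos).2 (hΔle Δ hk.1)) (by norm_num) (by norm_num)
      exact ⟨m, fun _ _ => ⟨((lt_div_iff₀ hDpos).1 h1).le, (div_le_iff₀ hDpos).1 h2⟩⟩
    · exact ⟨0, fun h1 h2 => absurd ⟨h1, h2⟩ hk⟩
  choose ℓ hℓ using hlevel
  set A : ℕ → Finset ℕ := fun m => {k ∈ Finset.range N | Δ k ≠ 0 ∧ ℓ k = m} with hA
  have hAmem {k m : ℕ} (hk : k ∈ A m) : k < N ∧ Δ k ≠ 0 ∧ ℓ k = m := by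
    simpa [hA] using hk
  have hAle (m k : ℕ) (hk : k ∈ A m) : |Δ k| ≤ (1 / 2) ^ m * D := by
    obtain ⟨h1, h2, rfl⟩ := hAmem hk
    exact (hℓ k h1 h2).2
  have hcoef (m : ℕ) : ((A m).card : ℝ≥0∞) ^ θ * ENNReal.ofReal ((1 / 2) ^ m * D)
      ≤ K₀ * c ^ m * finNorm p₁ Δ N := by
    rcases hD0.eq_or_lt with hD0 | hDpos
    · simp [← hD0]
    have hs : ∑ k ∈ A m, |Δ k| ^ p ≤ D ^ p := by
      have h1 : D ^ p = ∑ k ∈ Finset.range N, |Δ k| ^ p := by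
        rw [hD, finNorm, if_neg hpt, ENNReal.toReal_rpow, ← ENNReal.rpow_mul,
          one_div_mul_cancel hp2.ne', ENNReal.rpow_one, ENNReal.toReal_sum (by simp)]
        simp_rw [← ENNReal.toReal_rpow, ENNReal.toReal_ofReal (abs_nonneg _)]
        rfl
      rw [h1]
      exact Finset.sum_le_sum_of_subset_of_nonneg (Finset.filter_subset _ _)
        fun _ _ _ => by positivity
    have := ENNReal.ofReal_le_ofReal (card_level_rpow_mul_le hp2 hθ hDpos Δ (A m) m
      (fun k hk => by obtain ⟨h1, h2, rfl⟩ := hAmem hk; exact (hℓ k h1 h2).1) hs)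
    rwa [ENNReal.ofReal_mul (by positivity),
      ENNReal.ofReal_mul (show (0 : ℝ) ≤ 2 ^ (p * θ) * (2 ^ (p * θ - 1)) ^ m by positivity),
      ENNReal.ofReal_mul (show (0 : ℝ) ≤ 2 ^ (p * θ) by positivity), ENNReal.ofReal_pow (by positivity), hDof,
      ← ENNReal.ofReal_rpow_of_nonneg (by positivity) hθ, ENNReal.ofReal_natCast] at this
  choose H hHm hH hHb using fun m => h r hr1 hρr Ω mΩ μ G d b N hd hN hb hb1 Δ (A m)
    ((1 / 2) ^ m * D) (by positivity) (hAle m)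
  set K := (Finset.range N).sup ℓ + 1
  refine ⟨fun ω => ∑ m ∈ Finset.range K, H m ω, Finset.measurable_fun_sum _ fun m _ => hHm m,
    ?_, fun ω M hM hM0 => ?_⟩
  · set S := (∫⁻ ω, ENNReal.ofReal (sqFun d N ω) ^ q₀ ∂μ) ^ (1 / q₀)
    calc _ ≤ ∑ m ∈ Finset.range K, (∫⁻ ω, H m ω ^ q₀ ∂μ) ^ (1 / q₀) :=
          lintegral_sum_rpow_rpow_le μ hq₀ _ hHm
      _ ≤ ∑ m ∈ Finset.range K, C * (K₀ * c ^ m * finNorm p₁ Δ N) * S :=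
          Finset.sum_le_sum fun m _ => (hH m).trans
            (mul_le_mul' (mul_le_mul' le_rfl (hcoef m)) le_rfl)
      _ = C * (K₀ * ∑ m ∈ Finset.range K, c ^ m) * finNorm p₁ Δ N * S := by
          simp_rw [Finset.mul_sum, Finset.sum_mul]
          refine Finset.sum_congr rfl fun m _ => by ring
      _ ≤ _ := by
          refine mul_le_mul' (mul_le_mul' (mul_le_mul' le_rfl (mul_le_mul' le_rfl ?_)) le_rfl) le_rfl
          rw [← ENNReal.tsum_geometric]
          exact ENNReal.sum_le_tsum _
  · have heq (k : ℕ) : M k * (b k ω * Δ k * d k ω) = ∑ m ∈ Finset.range K,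
        if k ∈ A m then M k * (b k ω * Δ k * d k ω) else 0 := by
      by_cases hk : k < N ∧ Δ k ≠ 0
      · rw [Finset.sum_eq_single (ℓ k)]
        · simp [hA, hk]
        · intro m _ hm
          exact if_neg fun h => hm (hAmem h).2.2.symm
        · intro h
          exact absurd (Finset.mem_range.2 (Nat.lt_succ_of_le
            (Finset.le_sup (f := ℓ) (Finset.mem_range.2 hk.1)))) h
      · have h0 : M k * (b k ω * Δ k * d k ω) = 0 := by
          rcases not_and_or.1 hk with h | h
          · rw [hN k (not_lt.1 h)]; simp
          · rw [not_not.1 h]; simp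
        simp [h0]
    have heq' (n : ℕ) : ∑ k ∈ Finset.range n, M k * (b k ω * Δ k * d k ω)
        = ∑ m ∈ Finset.range K, ∑ k ∈ Finset.range n,
          if k ∈ A m then M k * (b k ω * Δ k * d k ω) else 0 := by
      rw [Finset.sum_comm]
      exact Finset.sum_congr rfl fun k _ => heq k
    simp_rw [heq', Finset.mul_sum]
    exact (seqVar_sum_le hr1 _ _).trans (Finset.sum_le_sum fun m _ => hHb m ω M hM hM0)

lemma lqNorm_mono {Ω : Type*} {mΩ : MeasurableSpace Ω} (μ : Measure Ω) (q : ℝ≥0∞)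
    {f g : Ω → ℝ≥0∞} (h : ∀ ω, f ω ≤ g ω) : lqNorm μ q f ≤ lqNorm μ q g := by
  rw [lqNorm, lqNorm]
  split_ifs
  · exact essSup_mono_ae (Eventually.of_forall h)
  · gcongr with ω
    exact h ω

lemma lqNorm_ofReal {Ω : Type*} {mΩ : MeasurableSpace Ω} (μ : Measure Ω) {q : ℝ} (hq : 0 ≤ q)
    (f : Ω → ℝ≥0∞) : lqNorm μ (ENNReal.ofReal q) f = (∫⁻ ω, f ω ^ q ∂μ) ^ (1 / q) := by
  rw [lqNorm, if_neg ENNReal.ofReal_ne_top, ENNReal.toReal_ofReal hq]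

lemma exists_ofReal_of_one_div_eq {q₀ : ℝ} {q₁ q : ℝ≥0∞} (hq₀ : 0 < q₀) (hq₁ : 0 < q₁)
    (hq : 1 / q = ENNReal.ofReal (1 / q₀) + 1 / q₁) :
    (q₁ = ∞ ∧ q = ENNReal.ofReal q₀) ∨ ∃ s t : ℝ, 0 < s ∧ 0 < t ∧ q₁ = ENNReal.ofReal s ∧
      q = ENNReal.ofReal t ∧ 1 / t = 1 / q₀ + 1 / s := by
  have key {q : ℝ≥0∞} {x : ℝ} (hx : 0 < x) (h : 1 / q = ENNReal.ofReal x) :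
      q = ENNReal.ofReal x⁻¹ := by
    rw [ENNReal.ofReal_inv_of_pos hx, ← h, one_div, inv_inv]
  rcases eq_or_ne q₁ ∞ with h | h
  · refine Or.inl ⟨h, ?_⟩
    rw [h, ENNReal.div_top, add_zero] at hq
    rw [key (by positivity) hq, one_div, inv_inv]
  · have hs : 0 < q₁.toReal := ENNReal.toReal_pos hq₁.ne' h
    refine Or.inr ⟨q₁.toReal, (1 / q₀ + 1 / q₁.toReal)⁻¹, hs, by positivity,
      (ENNReal.ofReal_toReal h).symm, key (by positivity) ?_, by rw [one_div, inv_inv]⟩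
    rw [hq, ENNReal.ofReal_add (by positivity) (by positivity), ENNReal.ofReal_div_of_pos hs,
      ENNReal.ofReal_toReal h, ENNReal.ofReal_one]

lemma lqNorm_mul_le {Ω : Type*} {mΩ : MeasurableSpace Ω} (μ : Measure Ω) {q₀ : ℝ} {q₁ q : ℝ≥0∞}
    (hq₀ : 0 < q₀) (hq₁ : 0 < q₁) (hq : 1 / q = ENNReal.ofReal (1 / q₀) + 1 / q₁)
    {f g : Ω → ℝ≥0∞} (hf : Measurable f) (hg : Measurable g) :
    lqNorm μ q (fun ω => f ω * g ω) ≤ lqNorm μ q₁ f * lqNorm μ (ENNReal.ofReal q₀) g := by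
  rcases exists_ofReal_of_one_div_eq hq₀ hq₁ hq with ⟨rfl, rfl⟩ | ⟨s, t, hs, ht, rfl, rfl, hst⟩
  · rw [lqNorm_ofReal μ hq₀.le, lqNorm_ofReal μ hq₀.le, lqNorm, if_pos rfl]
    have h1 : ∫⁻ ω, (f ω * g ω) ^ q₀ ∂μ ≤ essSup f μ ^ q₀ * ∫⁻ ω, g ω ^ q₀ ∂μ := by
      rw [← lintegral_const_mul _ (hg.pow_const _)]
      refine lintegral_mono_ae ((ENNReal.ae_le_essSup f).mono fun ω hω => ?_)
      rw [ENNReal.mul_rpow_of_nonneg _ _ hq₀.le]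
      gcongr
    refine (ENNReal.rpow_le_rpow h1 (by positivity)).trans_eq ?_
    rw [ENNReal.mul_rpow_of_nonneg _ _ (by positivity), ← ENNReal.rpow_mul,
      mul_one_div_cancel hq₀.ne', ENNReal.rpow_one]
  · rw [lqNorm_ofReal μ hq₀.le, lqNorm_ofReal μ hs.le, lqNorm_ofReal μ ht.le]
    refine ENNReal.lintegral_Lp_mul_le_Lq_mul_Lr ht ?_ (by rw [hst, add_comm]) μ
      hf.aemeasurable hg.aemeasurable
    rw [← one_div_lt_one_div hs ht, hst]
    exact lt_add_of_pos_left _ (by positivity)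

/-- Variational bound for discrete martingale transforms. -/
lemma exists_lqNorm_seqVar_le {q₀ r : ℝ} {q₁ q p₁ : ℝ≥0∞} (hq₀ : 1 ≤ q₀) (hq₁ : 0 < q₁)
    (hq : 1 / q = ENNReal.ofReal (1 / q₀) + 1 / q₁) (hp₁ : 2 ≤ p₁) (hr : 0 < r)
    (hrp : ENNReal.ofReal (1 / r) < 1 / 2 + 1 / p₁) :
    ∃ C : ℝ≥0∞, C < ∞ ∧
      ∀ (Ω : Type) (mΩ : MeasurableSpace Ω) (μ : Measure Ω)
      (G : Filtration ℕ mΩ) (d a : ℕ → Ω → ℝ) (N : ℕ), IsMartingaleDiff μ G d →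
      (∀ k, N ≤ k → ∀ ω, d k ω = 0) → (∀ k, Measurable[G k] (a k)) →
      ∀ (Δ : ℕ → ℝ) (Y : Ω → ℝ≥0∞), (∀ k ω, ENNReal.ofReal |a k ω| ≤ Y ω) →
      lqNorm μ q (fun ω => seqVar r fun n => ∑ k ∈ Finset.range n, a k ω * Δ k * d k ω)
        ≤ C * lqNorm μ q₁ Y * finNorm p₁ Δ N
          * lqNorm μ (ENNReal.ofReal q₀) fun ω => ENNReal.ofReal (sqFun d N ω) := by
  obtain ⟨C, hC, h⟩ := exists_transform_seqVar_le hq₀ hp₁ hr hrp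
  have hq0 : 0 < q₀ := by linarith
  refine ⟨C, hC, fun Ω mΩ μ G d a N hd hN ha Δ Y hY => ?_⟩
  set M : Ω → ℕ → ℝ := fun ω => runMax fun k => a k ω with hM
  have haM (k : ℕ) (ω : Ω) : |a k ω| ≤ M ω k := abs_le_runMax (fun k => a k ω) k
  have hM0 (k : ℕ) (ω : Ω) : 0 ≤ M ω k := runMax_nonneg _ _
  have hMm (k : ℕ) : Measurable[G k] fun ω => M ω k := by
    induction k with
    | zero => exact measurable_norm.comp (ha 0)
    | succ k ih => exact (ih.mono (G.mono k.le_succ) le_rfl).max (measurable_norm.comp (ha (k + 1)))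
  have hMY (k : ℕ) (ω : Ω) : ENNReal.ofReal (M ω k) ≤ Y ω := by
    induction k with
    | zero => exact hY 0 ω
    | succ k ih =>
      refine (ENNReal.ofReal_max _ _).trans_le (max_le ih (hY (k + 1) ω))
  obtain ⟨H, hHm, hH, hHb⟩ := h Ω mΩ μ G d (fun k ω => a k ω / M ω k) N hd hN
    (fun k => (ha k).div (hMm k)) (fun k ω => by
      rw [abs_div, abs_of_nonneg (hM0 k ω)]
      exact div_le_one_of_le₀ (haM k ω) (hM0 k ω)) Δ
  have hbound (ω : Ω) : seqVar r (fun n => ∑ k ∈ Finset.range n, a k ω * Δ k * d k ω)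
      ≤ ENNReal.ofReal (M ω N) * H ω := by
    refine le_trans (le_of_eq ?_) (hHb ω (M ω) (runMax_mono _) (hM0 0 ω))
    congr 1
    funext n
    refine Finset.sum_congr rfl fun k _ => ?_
    rcases (hM0 k ω).eq_or_lt with h0 | h0
    · rw [abs_nonpos_iff.1 ((haM k ω).trans_eq h0.symm)]; simp
    · field_simp
  refine (lqNorm_mono μ q hbound).trans ((lqNorm_mul_le μ hq0 hq₁ hq
    ((hMm N).mono (G.le N) le_rfl).ennreal_ofReal hHm).trans ?_)
  rw [← lqNorm_ofReal μ hq0.le, ← lqNorm_ofReal μ hq0.le] at hH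
  calc _ ≤ lqNorm μ q₁ Y * (C * finNorm p₁ Δ N
        * lqNorm μ (ENNReal.ofReal q₀) fun ω => ENNReal.ofReal (sqFun d N ω)) :=
      mul_le_mul' (lqNorm_mono μ q₁ (hMY N)) hH
    _ = _ := by ring

/-- The σ-algebra of events strictly before `t`. -/
abbrev strictPast {Ω : Type*} {mΩ : MeasurableSpace Ω} (ℱ : Filtration ℝ≥0 mΩ) (t : ℝ≥0) :
    MeasurableSpace Ω := ⨆ (s : ℝ≥0) (_ : s < t), ℱ s

section
variable {Ω : Type*} {mΩ : MeasurableSpace Ω} {ℱ : Filtration ℝ≥0 mΩ}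

lemma le_strictPast {s t : ℝ≥0} (h : s < t) : ℱ s ≤ strictPast ℱ t :=
  le_iSup₂ (f := fun (s : ℝ≥0) (_ : s < t) => ℱ s) s h

lemma strictPast_le_self (t : ℝ≥0) : strictPast ℱ t ≤ ℱ t :=
  iSup₂_le fun _ hs => ℱ.mono hs.le

lemma strictPast_le (t : ℝ≥0) : strictPast ℱ t ≤ mΩ := (strictPast_le_self t).trans (ℱ.le t)

lemma Cadlag.tendsto_leftLim {f : ℝ≥0 → ℝ} (hf : Cadlag f) {t : ℝ≥0} (ht : 0 < t) :
    Tendsto f (nhdsWithin t (Iio t)) (nhds (leftLim f t)) := by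
  exact tendsto_leftLim_of_tendsto (hf.2 t ht)

lemma Cadlag.tendsto_leftLim_seq {f : ℝ≥0 → ℝ} (hf : Cadlag f) {t : ℝ≥0} (ht : 0 < t)
    {s : ℕ → ℝ≥0} (hs : Tendsto s atTop (nhds t)) (hst : ∀ n, s n < t) :
    Tendsto (fun n => f (s n)) atTop (nhds (leftLim f t)) :=
  (hf.tendsto_leftLim ht).comp
    (tendsto_nhdsWithin_iff.2 ⟨hs, Eventually.of_forall hst⟩)

lemma exists_seq_strictMono_left {t : ℝ≥0} (ht : 0 < t) :
    ∃ s : ℕ → ℝ≥0, Monotone s ∧ (∀ n, s n < t) ∧ Tendsto s atTop (nhds t) := by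
  obtain ⟨s, hs, hst, hlim⟩ := exists_seq_strictMono_tendsto' ht
  exact ⟨s, hs.monotone, fun n => (hst n).2, hlim⟩

lemma measurable_leftLim {X : ℝ≥0 → Ω → ℝ} (hX : ∀ ω, Cadlag fun t => X t ω)
    (hXm : ∀ t, StronglyMeasurable[ℱ t] (X t)) {t : ℝ≥0} (ht : 0 < t) :
    Measurable[strictPast ℱ t] fun ω => leftLim (fun u => X u ω) t := by
  obtain ⟨s, -, hst, hlim⟩ := exists_seq_strictMono_left ht
  refine @measurable_of_tendsto_metrizable _ _ (strictPast ℱ t) _ _ _ _ (fun n ω => X (s n) ω) _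
    (fun n => (hXm (s n)).measurable.mono (le_strictPast (hst n)) le_rfl) ?_
  exact tendsto_pi_nhds.2 fun ω => (hX ω).tendsto_leftLim_seq ht hlim hst

lemma leftLim_ae_eq_condExp {μ : Measure Ω} [IsProbabilityMeasure μ] {g : ℝ≥0 → Ω → ℝ}
    (hg : Martingale g ℱ μ) (hgc : ∀ ω, Cadlag fun t => g t ω) {t : ℝ≥0} (ht : 0 < t) :
    (fun ω => leftLim (fun u => g u ω) t) =ᵐ[μ] μ[g t | strictPast ℱ t] := by
  obtain ⟨s, hs, hst, hlim⟩ := exists_seq_strictMono_left ht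
  set 𝒢 : Filtration ℕ mΩ := ⟨fun n => ℱ (s n), fun i j hij => ℱ.mono (hs hij), fun n => ℱ.le _⟩
    with h𝒢
  have hsup : ⨆ n, 𝒢 n = strictPast ℱ t := by
    refine le_antisymm (iSup_le fun n => le_strictPast (hst n)) (iSup₂_le fun u hu => ?_)
    obtain ⟨n, hn⟩ := (hlim.eventually (lt_mem_nhds hu)).exists
    exact (ℱ.mono hn.le).trans (le_iSup (fun n => 𝒢 n) n)
  have h1 := tendsto_ae_condExp (μ := μ) (ℱ := 𝒢) (g t)
  have h2 : ∀ᵐ ω ∂μ, ∀ n, (μ[g t | 𝒢 n]) ω = g (s n) ω :=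
    ae_all_iff.2 fun n => hg.condExp_ae_eq (hst n).le
  rw [hsup] at h1
  filter_upwards [h1, h2] with ω h1 h2
  simp_rw [h2] at h1
  exact tendsto_nhds_unique ((hgc ω).tendsto_leftLim_seq ht hlim hst) h1

lemma integrable_jump {μ : Measure Ω} [IsProbabilityMeasure μ] {g : ℝ≥0 → Ω → ℝ}
    (hg : Martingale g ℱ μ) (hgc : ∀ ω, Cadlag fun t => g t ω) {t : ℝ≥0} (ht : 0 < t) :
    Integrable (fun ω => g t ω - leftLim (fun u => g u ω) t) μ :=
  (hg.integrable t).sub (integrable_condExp.congr (leftLim_ae_eq_condExp hg hgc ht).symm)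

lemma integral_mul_jump {μ : Measure Ω} [IsProbabilityMeasure μ] {g : ℝ≥0 → Ω → ℝ}
    (hg : Martingale g ℱ μ) (hgc : ∀ ω, Cadlag fun t => g t ω) {t : ℝ≥0} (ht : 0 < t)
    {c : Ω → ℝ} (hc : Measurable[strictPast ℱ t] c) (hc1 : ∀ ω, |c ω| ≤ 1) :
    ∫ ω, c ω * (g t ω - leftLim (fun u => g u ω) t) ∂μ = 0 := by
  have hcm : AEStronglyMeasurable c μ := (hc.mono (strictPast_le t) le_rfl).aestronglyMeasurable
  have hb : ∀ᵐ ω ∂μ, ‖c ω‖ ≤ 1 := Eventually.of_forall hc1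
  have h1 : Integrable (fun ω => c ω * g t ω) μ := (hg.integrable t).bdd_mul hcm hb
  have h2 : Integrable (fun ω => c ω * (μ[g t | strictPast ℱ t]) ω) μ :=
    integrable_condExp.bdd_mul hcm hb
  have h3 : ∫ ω, c ω * g t ω ∂μ = ∫ ω, c ω * (μ[g t | strictPast ℱ t]) ω ∂μ := by
    rw [← integral_condExp (strictPast_le (ℱ := ℱ) t)]
    exact integral_congr_ae (condExp_mul_of_stronglyMeasurable_left hc.stronglyMeasurable h1
      (hg.integrable t))
  calc _ = ∫ ω, (c ω * g t ω - c ω * (μ[g t | strictPast ℱ t]) ω) ∂μ := by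
        refine integral_congr_ae ?_
        filter_upwards [leftLim_ae_eq_condExp hg hgc ht] with ω hω
        simp only [hω, mul_sub]
    _ = 0 := by rw [integral_sub h1 h2, h3, sub_self]

/-- The discrete filtration of strict pasts at finitely many times `τ 0 < ⋯ < τ (N - 1)`. -/
def jumpFiltration (ℱ : Filtration ℝ≥0 mΩ) (τ : ℕ → ℝ≥0) (N : ℕ)
    (hτ : StrictMonoOn τ (Iio N)) : Filtration ℕ mΩ where
  seq k := if k < N then strictPast ℱ (τ k) else mΩ
  mono' i j hij := by
    dsimp only
    split_ifs with hi hj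
    · exact iSup₂_le fun s hs => le_strictPast (hs.trans_le (hτ.monotoneOn hi hj hij))
    · exact strictPast_le _
    · omega
    · exact le_rfl
  le' k := by
    split_ifs
    · exact strictPast_le _
    · exact le_rfl

lemma jumpFiltration_of_lt {τ : ℕ → ℝ≥0} {N : ℕ} (hτ : StrictMonoOn τ (Iio N)) {k : ℕ}
    (hk : k < N) : jumpFiltration ℱ τ N hτ k = strictPast ℱ (τ k) := if_pos hk

lemma le_jumpFiltration_succ {τ : ℕ → ℝ≥0} {N : ℕ} (hτ : StrictMonoOn τ (Iio N)) {k : ℕ}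
    (hk : k < N) : ℱ (τ k) ≤ jumpFiltration ℱ τ N hτ (k + 1) := by
  by_cases h : k + 1 < N
  · rw [jumpFiltration_of_lt hτ h]
    exact le_strictPast (hτ hk h k.lt_succ_self)
  · exact (ℱ.le _).trans_eq (if_neg h).symm

lemma isMartingaleDiff_jump {μ : Measure Ω} [IsProbabilityMeasure μ] {g : ℝ≥0 → Ω → ℝ}
    (hg : Martingale g ℱ μ) (hgc : ∀ ω, Cadlag fun t => g t ω) {τ : ℕ → ℝ≥0} {N : ℕ}
    (hτ : StrictMonoOn τ (Iio N)) (hτ0 : ∀ k < N, 0 < τ k) :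
    IsMartingaleDiff μ (jumpFiltration ℱ τ N hτ) fun k ω =>
      if k < N then g (τ k) ω - leftLim (fun u => g u ω) (τ k) else 0 where
  meas k := by
    split_ifs with hk
    · refine Measurable.mono (Measurable.sub (hg.stronglyMeasurable (τ k)).measurable
        ((measurable_leftLim hgc hg.stronglyMeasurable (hτ0 k hk)).mono
          (strictPast_le_self _) le_rfl)) (le_jumpFiltration_succ hτ hk) le_rfl
    · exact measurable_const
  integrable k := by
    split_ifs with hk
    · exact integrable_jump hg hgc (hτ0 k hk)
    · exact integrable_zero _ _ _
  integral_mul k c hc hc1 := by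
    split_ifs with hk
    · rw [jumpFiltration_of_lt hτ hk] at hc
      exact integral_mul_jump hg hgc (hτ0 k hk) hc hc1
    · simp

lemma measurable_leftLim_jumpFiltration {X : ℝ≥0 → Ω → ℝ} (hX : ∀ ω, Cadlag fun t => X t ω)
    (hXm : ∀ t, StronglyMeasurable[ℱ t] (X t)) {τ : ℕ → ℝ≥0} {N : ℕ}
    (hτ : StrictMonoOn τ (Iio N)) (hτ0 : ∀ k < N, 0 < τ k) (k : ℕ) :
    Measurable[jumpFiltration ℱ τ N hτ k] fun ω =>
      if k < N then leftLim (fun u => X u ω) (τ k) else 0 := by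
  split_ifs with hk
  · rw [jumpFiltration_of_lt hτ hk]
    exact measurable_leftLim hX hXm (hτ0 k hk)
  · exact measurable_const

end

lemma Cadlag.ofReal_abs_leftLim_le {f : ℝ≥0 → ℝ} (hf : Cadlag f) {t : ℝ≥0} (ht : 0 < t) :
    ENNReal.ofReal |leftLim f t| ≤ ⨆ s, ENNReal.ofReal |f s| := by
  obtain ⟨s, -, hst, hlim⟩ := exists_seq_strictMono_left ht
  exact le_of_tendsto
    ((ENNReal.continuous_ofReal.tendsto _).comp (hf.tendsto_leftLim_seq ht hlim hst).abs)
    (Eventually.of_forall fun n => le_iSup (fun s => ENNReal.ofReal |f s|) (s n))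

lemma sum_range_card_filter_le {τ : ℕ → ℝ≥0} {N : ℕ} (hτ : StrictMonoOn τ (Iio N)) (x : ℝ≥0 → ℝ)
    (t : ℝ≥0) :
    ∑ k ∈ Finset.range ((Finset.range N).filter fun k => τ k ≤ t).card, x (τ k)
      = ∑ k ∈ Finset.range N, if τ k ≤ t then x (τ k) else 0 := by
  rw [← Finset.sum_filter]
  congr 1
  refine (Finset.eq_of_subset_of_card_le (fun k hk => ?_) (by simp)).symm
  obtain ⟨hkN, hkt⟩ := Finset.mem_filter.1 hk
  rw [Finset.mem_range] at hkN ⊢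
  have : Finset.range (k + 1) ⊆ (Finset.range N).filter fun k => τ k ≤ t := fun i hi => by
    have hik : i ≤ k := Nat.lt_succ_iff.1 (Finset.mem_range.1 hi)
    exact Finset.mem_filter.2 ⟨Finset.mem_range.2 (hik.trans_lt hkN),
      (hτ.monotoneOn (mem_Iio.2 (hik.trans_lt hkN)) (mem_Iio.2 hkN) hik).trans hkt⟩
  simpa using Finset.card_le_card this

/-- The variation of the increments over `(t, t']` of a finite pure jump path is at most the
variation of the sequence of partial sums of its jumps. -/
lemma VvarR_finite_jumps_le {r : ℝ} {τ : ℕ → ℝ≥0} {N : ℕ} (hτ : StrictMonoOn τ (Iio N))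
    (x : ℝ≥0 → ℝ) {y : ℕ → ℝ} (hy : ∀ k < N, y k = x (τ k)) :
    VvarR r (fun t t' => ∑ k ∈ Finset.range N, if t < τ k ∧ τ k ≤ t' then x (τ k) else 0)
      ≤ seqVar r fun n => ∑ k ∈ Finset.range n, y k := by
  set ν : ℝ≥0 → ℕ := fun t => ((Finset.range N).filter fun k => τ k ≤ t).card with hν
  have hνm : Monotone ν := fun s t hst => Finset.card_le_card fun k hk => by
    simp only [Finset.mem_filter] at hk ⊢
    exact ⟨hk.1, hk.2.trans hst⟩
  have hνN : ∀ t, ν t ≤ N := fun t => (Finset.card_filter_le _ _).trans (by simp)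
  have hsum : ∀ t, ∑ k ∈ Finset.range (ν t), y k
      = ∑ k ∈ Finset.range N, if τ k ≤ t then x (τ k) else 0 := fun t => by
    rw [← sum_range_card_filter_le hτ x t]
    exact Finset.sum_congr rfl fun k hk => hy k ((Finset.mem_range.1 hk).trans_le (hνN t))
  refine iSup_le fun L => iSup₂_le fun u hu => ?_
  refine le_trans (le_of_eq ?_) (le_seqVar r _ (hνm.comp hu))
  congr! 5 with l
  simp only [Function.comp_apply, hsum, ← Finset.sum_sub_distrib]
  refine Finset.sum_congr rfl fun k _ => ?_
  have h : u l.castSucc ≤ u l.succ := hu (Fin.castSucc_lt_succ (i := l)).le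
  by_cases h1 : τ k ≤ u l.castSucc
  · simp [h1, h1.trans h, h1.not_gt]
  · simp [h1, not_le.1 h1]

lemma hasSum_of_summable_interval {I : Set ℝ≥0} {x : ℝ≥0 → ℝ} {t t' : ℝ≥0}
    (h : Summable fun j : {j : ℝ≥0 // j ∈ I ∧ t < j ∧ j ≤ t'} => x j) :
    HasSum (fun j : I => if t < (j : ℝ≥0) ∧ (j : ℝ≥0) ≤ t' then x j else 0)
      (∑' j : {j : ℝ≥0 // j ∈ I ∧ t < j ∧ j ≤ t'}, x j) := by
  have h1 := (hasSum_subtype_iff_indicator (s := {j | j ∈ I ∧ t < j ∧ j ≤ t'})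
    (f := x)).1 h.hasSum
  have h2 : ({j | j ∈ I ∧ t < j ∧ j ≤ t'} : Set ℝ≥0).indicator x
      = I.indicator fun j => if t < j ∧ j ≤ t' then x j else 0 := by
    ext j
    by_cases hj : j ∈ I <;> simp [indicator, hj]
  rw [h2] at h1
  exact (hasSum_subtype_iff_indicator (s := I)
    (f := fun j => if t < j ∧ j ≤ t' then x j else 0)).2 h1

/-- Lower semicontinuity of the variation along an exhaustion of the jump times by finite sets. -/
lemma VvarR_tsum_le_liminf {r : ℝ} (hr : 0 < r) {I : Set ℝ≥0} (x : ℝ≥0 → ℝ) {K : ℕ → Finset I}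
    (hK : Tendsto K atTop atTop) :
    VvarR r (fun t t' => ∑' j : {j : ℝ≥0 // j ∈ I ∧ t < j ∧ j ≤ t'}, x j)
      ≤ liminf (fun n => VvarR r fun t t' =>
        ∑ j ∈ K n, if t < (j : ℝ≥0) ∧ (j : ℝ≥0) ≤ t' then x j else 0) atTop := by
  classical
  refine iSup_le fun L => iSup₂_le fun u hu => ?_
  set P : Fin L → ℝ :=
    fun l => ∑' j : {j : ℝ≥0 // j ∈ I ∧ u l.castSucc < j ∧ j ≤ u l.succ}, x j with hP
  set Q : ℕ → Fin L → ℝ := fun n l => ∑ j ∈ K n,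
    if u l.castSucc < (j : ℝ≥0) ∧ (j : ℝ≥0) ≤ u l.succ then x j else 0 with hQ
  have hlim : ∀ l, ∃ w : ℕ → ℝ, Tendsto w atTop (nhds (P l)) ∧ ∀ n, |w n| ≤ |Q n l| := fun l => by
    by_cases h : Summable fun j : {j : ℝ≥0 // j ∈ I ∧ u l.castSucc < j ∧ j ≤ u l.succ} => x j
    · exact ⟨fun n => Q n l, (hasSum_of_summable_interval h).comp hK, fun n => le_rfl⟩
    · refine ⟨fun _ => 0, ?_, fun n => by simp⟩
      simp only [hP, tsum_eq_zero_of_not_summable h, tendsto_const_nhds]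
  choose w hw hwQ using hlim
  have hcont : Continuous fun v : Fin L → ℝ =>
      (∑ l : Fin L, (ENNReal.ofReal |v l|) ^ r) ^ (1 / r) :=
    ENNReal.continuous_rpow_const.comp (continuous_finsetSum _ fun l _ =>
      ENNReal.continuous_rpow_const.comp
        (ENNReal.continuous_ofReal.comp (continuous_apply l).abs))
  have h1 := (hcont.tendsto P).comp (tendsto_pi_nhds.2 hw)
  rw [← h1.liminf_eq]
  refine liminf_le_liminf (Eventually.of_forall fun n => ?_)
  refine le_trans ?_ (le_iSup_of_le L (le_iSup₂_of_le u hu le_rfl))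
  simp only [Function.comp_apply]
  gcongr ?_ ^ _
  refine Finset.sum_le_sum fun l _ => ?_
  gcongr ?_ ^ _
  exact ENNReal.ofReal_le_ofReal (hwQ l n)

lemma lqNorm_liminf_le {Ω : Type*} {mΩ : MeasurableSpace Ω} (μ : Measure Ω) {t : ℝ} (ht : 0 < t)
    {F : ℕ → Ω → ℝ≥0∞} (hF : ∀ n, Measurable (F n)) {A : ℝ≥0∞}
    (hA : ∀ n, lqNorm μ (ENNReal.ofReal t) (F n) ≤ A) :
    lqNorm μ (ENNReal.ofReal t) (fun ω => liminf (fun n => F n ω) atTop) ≤ A := by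
  simp only [lqNorm_ofReal μ ht.le, one_div] at hA ⊢
  rw [ENNReal.rpow_inv_le_iff ht]
  have h : ∀ ω, liminf (fun n => F n ω) atTop ^ t = liminf (fun n => F n ω ^ t) atTop := fun ω =>
    (ENNReal.orderIsoRpow t ht).liminf_apply
  simp_rw [h]
  refine (lintegral_liminf_le fun n => (hF n).pow_const t).trans ?_
  refine liminf_le_of_le (by isBoundedDefault) fun b hb => ?_
  obtain ⟨n, hn⟩ := hb.exists
  exact hn.trans ((ENNReal.rpow_inv_le_iff ht).1 (hA n))

lemma exists_strictMonoOn_image_range (J : Finset ℝ≥0) :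
    ∃ τ : ℕ → ℝ≥0, StrictMonoOn τ (Iio J.card) ∧ (Finset.range J.card).image τ = J := by
  refine ⟨fun k => if h : k < J.card then J.orderEmbOfFin rfl ⟨k, h⟩ else 0,
    fun i hi j hj hij => ?_, ?_⟩
  · simp only [mem_Iio] at hi hj
    simpa [hi, hj] using hij
  · ext x
    simp only [Finset.mem_image, Finset.mem_range]
    constructor
    · rintro ⟨k, hk, rfl⟩
      simp [hk]
    · intro hx
      obtain ⟨⟨k, hk⟩, rfl⟩ : x ∈ Set.range (J.orderEmbOfFin rfl) := by simpa using hx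
      exact ⟨k, hk, by simp [hk]⟩

lemma StrictMonoOn.sum_range_comp {τ : ℕ → ℝ≥0} {J : Finset ℝ≥0}
    (hτ : StrictMonoOn τ (Iio J.card)) (hJ : (Finset.range J.card).image τ = J) {M : Type*}
    [AddCommMonoid M] (f : ℝ≥0 → M) :
    ∑ k ∈ Finset.range J.card, f (τ k) = ∑ j ∈ J, f j := by
  conv_rhs => rw [← hJ]
  exact (Finset.sum_image (by simpa using hτ.injOn)).symm

/-- The bound for the jumps at finitely many times, with the constants of the discrete theorem. -/
lemma exists_lqNorm_finite_jumps_le {q₀ r : ℝ} {q₁ q p₁ : ℝ≥0∞} (hq₀ : 1 ≤ q₀) (hq₁ : 0 < q₁)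
    (hq : 1 / q = ENNReal.ofReal (1 / q₀) + 1 / q₁) (hp₁ : 2 ≤ p₁) (hr : 0 < r)
    (hrp : ENNReal.ofReal (1 / r) < 1 / 2 + 1 / p₁) :
    ∃ C : ℝ≥0∞, C < ∞ ∧
      ∀ (Ω : Type) (mΩ : MeasurableSpace Ω) (μ : Measure Ω), IsProbabilityMeasure μ →
      ∀ (ℱ : Filtration ℝ≥0 mΩ) (g X : ℝ≥0 → Ω → ℝ) (J : Finset ℝ≥0) (Δ : ℝ≥0 → ℝ),
        Martingale g ℱ μ → (∀ ω, Cadlag fun t => g t ω) → (∀ ω, Cadlag fun t => X t ω) →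
        (∀ t, StronglyMeasurable[ℱ t] (X t)) → (∀ s ∈ J, 0 < s) →
        ∃ F : Ω → ℝ≥0∞, Measurable F ∧
          (∀ ω, VvarR r (fun t t' => ∑ j ∈ J, if t < j ∧ j ≤ t' then
              leftLim (fun u => X u ω) j * Δ j * (g j ω - leftLim (fun u => g u ω) j) else 0)
            ≤ F ω) ∧
          lqNorm μ q F ≤ C * lqNorm μ q₁ (fun ω => ⨆ t : ℝ≥0, ENNReal.ofReal |X t ω|)
            * (if p₁ = ∞ then ⨆ (j : ℝ≥0) (_ : j ∈ J), ENNReal.ofReal |Δ j|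
                else (∑ j ∈ J, ENNReal.ofReal |Δ j| ^ p₁.toReal) ^ (1 / p₁.toReal))
            * lqNorm μ (ENNReal.ofReal q₀) (fun ω =>
                (∑ j ∈ J, ENNReal.ofReal ((g j ω - leftLim (fun u => g u ω) j) ^ 2))
                  ^ ((2 : ℝ)⁻¹)) := by
  obtain ⟨C, hC, h⟩ := exists_lqNorm_seqVar_le hq₀ hq₁ hq hp₁ hr hrp
  refine ⟨C, hC, fun Ω mΩ μ _ ℱ g X J Δ hg hgc hXc hX hJ0 => ?_⟩
  obtain ⟨τ, hτ, hτJ⟩ := exists_strictMonoOn_image_range J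
  have hmem : ∀ k < J.card, τ k ∈ J := fun k hk =>
    hτJ.le (Finset.mem_image_of_mem τ (Finset.mem_range.2 hk))
  have hτ0 : ∀ k < J.card, 0 < τ k := fun k hk => hJ0 _ (hmem k hk)
  set d : ℕ → Ω → ℝ := fun k ω =>
    if k < J.card then g (τ k) ω - leftLim (fun u => g u ω) (τ k) else 0 with hd
  set a : ℕ → Ω → ℝ := fun k ω =>
    if k < J.card then leftLim (fun u => X u ω) (τ k) else 0 with ha
  have hdm := isMartingaleDiff_jump hg hgc hτ hτ0
  have ham := measurable_leftLim_jumpFiltration hXc hX hτ hτ0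
  refine ⟨fun ω => seqVar r fun n => ∑ k ∈ Finset.range n, a k ω * Δ (τ k) * d k ω,
    measurable_seqVar r fun n => Finset.measurable_fun_sum _ fun k _ =>
      (((ham k).mono ((jumpFiltration ℱ τ _ hτ).le k) le_rfl).mul_const _).mul
        ((hdm.meas k).mono ((jumpFiltration ℱ τ _ hτ).le _) le_rfl), fun ω => ?_, ?_⟩
  · simp_rw [← hτ.sum_range_comp hτJ]
    exact VvarR_finite_jumps_le hτ (fun j => leftLim (fun u => X u ω) j * Δ j
      * (g j ω - leftLim (fun u => g u ω) j)) fun k hk => by simp [ha, hd, hk]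
  · refine (h Ω mΩ μ (jumpFiltration ℱ τ _ hτ) d a J.card hdm (fun k hk ω => if_neg hk.not_gt) ham
      (fun k => Δ (τ k)) (fun ω => ⨆ t : ℝ≥0, ENNReal.ofReal |X t ω|) fun k ω => ?_).trans_eq ?_
    · simp only [ha]
      split_ifs with hk
      · exact (hXc ω).ofReal_abs_leftLim_le (hτ0 k hk)
      · simp
    · congr 2
      · rw [finNorm, ← hτ.sum_range_comp hτJ fun j => ENNReal.ofReal |Δ j| ^ p₁.toReal]
        congr 1
        have hsup := Finset.sup_image (Finset.range J.card) τ fun j => ENNReal.ofReal |Δ j|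
        rw [hτJ] at hsup
        simpa [Finset.sup_eq_iSup] using hsup.symm
      · funext ω
        rw [sqFun, ← hτ.sum_range_comp hτJ, Real.sqrt_eq_rpow, ← one_div,
          ← ENNReal.ofReal_rpow_of_nonneg (by positivity) (by positivity),
          ENNReal.ofReal_sum_of_nonneg fun _ _ => sq_nonneg _]
        congr 1
        exact Finset.sum_congr rfl fun k hk => by simp [hd, Finset.mem_range.1 hk]

/-- jump-sum bound for controlled brackets:
for `B_{t,t'} = Σ_{j ∈ I ∩ (t,t']} Y'_{j-} Δ_j (g_j − g_{j-})`, `p₁ ∈ [2,∞]` and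
`1/r < 1/2 + 1/p₁`,
`‖V^r B‖_{L^q} ≤ C ‖M Y'‖_{L^{q₁}} (Σ_j |Δ_j|^{p₁})^{1/p₁} ‖(Σ_j |Δg_j|²)^{1/2}‖_{L^{q₀}}`. -/
theorem jump_sum_bracket_bound (q₀ : ℝ) (q₁ q p₁ : ℝ≥0∞) (r : ℝ)
    (hq₀ : 1 ≤ q₀) (hq₁ : 0 < q₁)
    (hq : 1 / q = ENNReal.ofReal (1 / q₀) + 1 / q₁)
    (hp₁ : 2 ≤ p₁) (hr : 0 < r)
    (hrp : ENNReal.ofReal (1 / r) < 1 / 2 + 1 / p₁) :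
    ∃ C : ℝ≥0∞, C < ∞ ∧
      ∀ (Ω : Type) (mΩ : MeasurableSpace Ω) (μ : Measure Ω), IsProbabilityMeasure μ →
      ∀ (ℱ : Filtration ℝ≥0 mΩ) (g Y' : ℝ≥0 → Ω → ℝ) (I : Set ℝ≥0) (Δ : ℝ≥0 → ℝ),
        Martingale g ℱ μ →
        (∀ ω, Cadlag fun t => g t ω) →
        (∀ ω, Cadlag fun t => Y' t ω) →
        (∀ t, StronglyMeasurable[ℱ t] (Y' t)) →
        I.Countable →
        (∀ s ∈ I, 0 < s) →
        lqNorm μ q (fun ω => VvarR r fun t t' =>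
            ∑' j : {j : ℝ≥0 // j ∈ I ∧ t < j ∧ j ≤ t'},
              leftLim (fun u => Y' u ω) (j : ℝ≥0) * Δ (j : ℝ≥0)
                * (g (j : ℝ≥0) ω - leftLim (fun u => g u ω) (j : ℝ≥0)))
          ≤ C * lqNorm μ q₁ (fun ω => ⨆ t : ℝ≥0, ENNReal.ofReal |Y' t ω|)
              * (if p₁ = ∞ then ⨆ (j : ℝ≥0) (_ : j ∈ I), ENNReal.ofReal |Δ j|
                 else (∑' j : I, ENNReal.ofReal |Δ (j : ℝ≥0)| ^ p₁.toReal) ^ (1 / p₁.toReal))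
              * lqNorm μ (ENNReal.ofReal q₀) (fun ω =>
                  (∑' j : I, ENNReal.ofReal
                      ((g (j : ℝ≥0) ω - leftLim (fun u => g u ω) (j : ℝ≥0)) ^ 2))
                    ^ ((2 : ℝ)⁻¹)) := by
  classical
  obtain ⟨C, hC, h⟩ := exists_lqNorm_finite_jumps_le hq₀ hq₁ hq hp₁ hr hrp
  refine ⟨C, hC, fun Ω mΩ μ hμ ℱ g Y' I Δ hg hgc hYc hY hI hI0 => ?_⟩
  obtain ⟨t, ht, rfl⟩ : ∃ t : ℝ, 0 < t ∧ q = ENNReal.ofReal t := by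
    rcases exists_ofReal_of_one_div_eq (by linarith) hq₁ hq with ⟨-, hq'⟩ | ⟨s, t, -, ht, -, hq', -⟩
    · exact ⟨q₀, by linarith, hq'⟩
    · exact ⟨t, ht, hq'⟩
  have : Countable I := hI
  obtain ⟨K, hK⟩ := exists_seq_tendsto (atTop : Filter (Finset I))
  choose F hFm hFV hFA using fun n => h Ω mΩ μ hμ ℱ g Y' ((K n).map (Embedding.subtype _)) Δ
    hg hgc hYc hY fun s hs => by
      obtain ⟨j, -, rfl⟩ := Finset.mem_map.1 hs
      exact hI0 _ j.2
  simp only [Finset.sum_map, Embedding.subtype_apply] at hFV hFA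
  refine (lqNorm_mono μ _ fun ω => (VvarR_tsum_le_liminf hr (fun j => leftLim (fun u => Y' u ω) j
    * Δ j * (g j ω - leftLim (fun u => g u ω) j)) hK).trans
      (liminf_le_liminf (Eventually.of_forall fun n => hFV n ω))).trans
    (lqNorm_liminf_le μ ht hFm fun n => (hFA n).trans ?_)
  refine mul_le_mul' (mul_le_mul_right ?_ _) ?_
  · split_ifs with hp
    · refine iSup₂_le fun j hj => ?_
      obtain ⟨i, -, rfl⟩ := Finset.mem_map.1 hj
      exact le_iSup₂ (f := fun (j : ℝ≥0) (_ : j ∈ I) => ENNReal.ofReal |Δ j|) i.1 i.2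
    · exact ENNReal.rpow_le_rpow (ENNReal.sum_le_tsum _) (by positivity)
  · exact lqNorm_mono μ _ fun ω => ENNReal.rpow_le_rpow (ENNReal.sum_le_tsum _) (by positivity)
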